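/- The set Σ of small roots is bipodal: for every small root β and every maximal rank 2 root subsystem Φ' of Φ with canonical basis Δ', if β ∈ Φ' \ Δ', then Δ' ⊆ Σ. -/

import Mathlib

section RootSystemDefs

variable {S : Type*} {W : Type*} [Group W]

/-- The simple root `α_s` in the vector space `V = S → ℝ`. -/
def simpleRoot [DecidableEq S] (s : S) : S → ℝ := Pi.single s 1

/-- The symmetric bilinear form `B` on `V = S → ℝ` with `B(α_s, α_t) = -cos (π / m s t)`
(with the convention that `B(α_s, α_t) = -1` when `m s t = ∞`, which is encoded by
`Mmat s t = 0`). -/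
noncomputable def bform [Fintype S] (Mmat : CoxeterMatrix S) (v u : S → ℝ) : ℝ :=
  ∑ s : S, ∑ t : S,
    v s * u t * (if Mmat s t = 0 then -1 else -Real.cos (Real.pi / (Mmat s t : ℝ)))

/-- The conic closure of `X`: all nonnegative linear combinations of elements of `X`. -/
def coneOf {V : Type*} [AddCommMonoid V] [Module ℝ V] (X : Set V) : Set V :=
  {v | ∃ (n : ℕ) (c : Fin n → ℝ) (x : Fin n → V),
    (∀ i, 0 ≤ c i) ∧ (∀ i, x i ∈ X) ∧ v = ∑ i, c i • x i}

variable [Fintype S] [DecidableEq S] {Mmat : CoxeterMatrix S}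

/-- The root system `Φ = W(Δ)`, for the representation `ρ` of `W` on `V = S → ℝ`. -/
def rootSet (ρ : W →* ((S → ℝ) ≃ₗ[ℝ] (S → ℝ))) : Set (S → ℝ) :=
  {v | ∃ (w : W) (s : S), v = ρ w (simpleRoot s)}

/-- The positive roots `Φ⁺ = cone(Δ) ∩ Φ`. -/
def posRoots (ρ : W →* ((S → ℝ) ≃ₗ[ℝ] (S → ℝ))) : Set (S → ℝ) :=
  coneOf (Set.range (simpleRoot (S := S))) ∩ rootSet ρ

/-- The negative roots `Φ⁻ = -Φ⁺`. -/
def negRoots (ρ : W →* ((S → ℝ) ≃ₗ[ℝ] (S → ℝ))) : Set (S → ℝ) :=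
  {v | -v ∈ posRoots ρ}

/-- Dominance order: `Dominates ρ a b` means `a ≼ b`, i.e. every `w ∈ W` sending `b` to a
negative root also sends `a` to a negative root. -/
def Dominates (ρ : W →* ((S → ℝ) ≃ₗ[ℝ] (S → ℝ))) (a b : S → ℝ) : Prop :=
  ∀ w : W, ρ w b ∈ negRoots ρ → ρ w a ∈ negRoots ρ

/-- A small root: a positive root dominating no positive root other than itself. -/
def IsSmallRoot (ρ : W →* ((S → ℝ) ≃ₗ[ℝ] (S → ℝ))) (b : S → ℝ) : Prop :=
  b ∈ posRoots ρ ∧ ∀ a ∈ posRoots ρ, Dominates ρ a b → a = b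

/-- `t : W` is the reflection `s_b` in the root `b`: it acts on `V` by
`v ↦ v - 2 B(b, v) b`. -/
def IsReflIn (Mmat : CoxeterMatrix S) (ρ : W →* ((S → ℝ) ≃ₗ[ℝ] (S → ℝ)))
    (t : W) (b : S → ℝ) : Prop :=
  ∀ v : S → ℝ, ρ t v = v - (2 * bform Mmat b v) • b

/-- The (left) inversion set `N(w) = Φ⁺ ∩ w(Φ⁻)`. -/
def invSet (ρ : W →* ((S → ℝ) ≃ₗ[ℝ] (S → ℝ))) (w : W) : Set (S → ℝ) :=
  {b | b ∈ posRoots ρ ∧ ρ w⁻¹ b ∈ negRoots ρ}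

/-- `N¹(w) = {α ∈ Φ⁺ : ℓ(s_α w) = ℓ(w) - 1}`. -/
def nOne (cs : CoxeterSystem Mmat W) (ρ : W →* ((S → ℝ) ≃ₗ[ℝ] (S → ℝ)))
    (w : W) : Set (S → ℝ) :=
  {b | b ∈ posRoots ρ ∧
    ∃ t : W, IsReflIn Mmat ρ t b ∧ cs.length (t * w) + 1 = cs.length w}

/-- A low element of `W`: an element `w` with `N¹(w) ⊆ Σ`. -/
def IsLow (cs : CoxeterSystem Mmat W) (ρ : W →* ((S → ℝ) ≃ₗ[ℝ] (S → ℝ)))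
    (w : W) : Prop :=
  ∀ b ∈ nOne cs ρ w, IsSmallRoot ρ b

end RootSystemDefs

namespace CoxeterSmall

section Reflections

variable {V : Type*} [AddCommGroup V] [Module ℝ V]

/-- The `B`-reflection `v ↦ v - 2 B(a, v) a`. -/
noncomputable def refl (B : LinearMap.BilinForm ℝ V) (a : V) : V →ₗ[ℝ] V :=
  LinearMap.id - (2 : ℝ) • (B a).smulRight a

lemma refl_apply (B : LinearMap.BilinForm ℝ V) (a v : V) :
    refl B a v = v - (2 * B a v) • a := by
  simp [refl, smul_smul]

lemma refl_self {B : LinearMap.BilinForm ℝ V} {a : V} (ha : B a a = 1) : refl B a a = -a := by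
  rw [refl_apply, ha]; module

lemma refl_refl {B : LinearMap.BilinForm ℝ V} {a : V} (ha : B a a = 1) (v : V) :
    refl B a (refl B a v) = v := by
  simp only [refl_apply, map_sub, map_smul, ha]; module

lemma form_refl_refl {B : LinearMap.BilinForm ℝ V} (hB : ∀ x y, B x y = B y x) {a : V}
    (ha : B a a = 1) (v w : V) : B (refl B a v) (refl B a w) = B v w := by
  simp only [refl_apply, map_sub, map_smul, ha, smul_eq_mul, LinearMap.sub_apply,
    LinearMap.smul_apply, hB v a]
  ring

/-- A linear map preserving the form conjugates reflections. -/
lemma map_refl {V' : Type*} [AddCommGroup V'] [Module ℝ V'] {B : LinearMap.BilinForm ℝ V}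
    {B' : LinearMap.BilinForm ℝ V'} (g : V →ₗ[ℝ] V') (hg : ∀ x y, B' (g x) (g y) = B x y)
    (a v : V) : g (refl B a v) = refl B' (g a) (g v) := by
  simp only [refl_apply, map_sub, map_smul, hg]

/-- The smallest set containing `X` and closed under reflecting its elements in one another. -/
inductive ReflClosure (B : LinearMap.BilinForm ℝ V) (X : Set V) : V → Prop
  | base {x : V} : x ∈ X → ReflClosure B X x
  | refl {x y : V} : ReflClosure B X x → ReflClosure B X y → ReflClosure B X (refl B x y)

lemma ReflClosure.trans {B : LinearMap.BilinForm ℝ V} {X Y : Set V}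
    (hXY : ∀ x ∈ X, ReflClosure B Y x) {v : V} (hv : ReflClosure B X v) : ReflClosure B Y v := by
  induction hv with
  | base h => exact hXY _ h
  | refl _ _ h1 h2 => exact .refl h1 h2

/-- The point at angle `φ` on the unit circle of the plane with orthonormal basis `a, n`. -/
noncomputable def circ (a n : V) (φ : ℝ) : V := Real.cos φ • a + Real.sin φ • n

/-- An orthonormal pair for `B`. -/
structure Orthonorm (B : LinearMap.BilinForm ℝ V) (a n : V) : Prop where
  left : B a a = 1
  right : B n n = 1
  ortho : B a n = 0
  ortho' : B n a = 0

namespace Orthonorm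

variable {B : LinearMap.BilinForm ℝ V} {a n : V} (h : Orthonorm B a n)
include h

lemma form_circ (φ ψ : ℝ) : B (circ a n φ) (circ a n ψ) = Real.cos (φ - ψ) := by
  simp only [circ, map_add, map_smul, LinearMap.add_apply, LinearMap.smul_apply, h.left, h.right,
    h.ortho, h.ortho', smul_eq_mul, Real.cos_sub]
  ring

lemma refl_circ (φ ψ : ℝ) :
    refl B (circ a n φ) (circ a n ψ) = circ a n (2 * φ - ψ + Real.pi) := by
  rw [refl_apply, h.form_circ]
  have e : 2 * φ - ψ = φ + (φ - ψ) := by ring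
  have e2 : ψ = φ - (φ - ψ) := by ring
  set δ := φ - ψ
  rw [e, e2]
  simp only [circ, Real.cos_add, Real.sin_add, Real.cos_sub, Real.sin_sub, Real.cos_pi,
    Real.sin_pi]
  module

end Orthonorm

lemma circ_add_pi (a n : V) (φ : ℝ) : circ a n (φ + Real.pi) = -circ a n φ := by
  simp only [circ, Real.cos_add_pi, Real.sin_add_pi]; module

lemma circ_zero (a n : V) : circ a n 0 = a := by simp [circ]

lemma circ_add_two_pi (a n : V) (φ : ℝ) : circ a n (φ + 2 * Real.pi) = circ a n φ := by
  simp [circ]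

end Reflections

end CoxeterSmall

namespace CoxeterSmall

section Form

variable {S : Type*} (M : CoxeterMatrix S)

/-- The value `B(α_s, α_t)` of the canonical form on simple roots. -/
noncomputable def formCoeff (s t : S) : ℝ :=
  if M s t = 0 then -1 else -Real.cos (Real.pi / (M s t : ℝ))

lemma formCoeff_comm (s t : S) : formCoeff M s t = formCoeff M t s := by
  simp only [formCoeff, M.symmetric s t]

lemma formCoeff_self (s : S) : formCoeff M s s = 1 := by
  simp [formCoeff]

variable [Fintype S]

/-- The canonical form `bform` as a bilinear form. -/
noncomputable def form : LinearMap.BilinForm ℝ (S → ℝ) :=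
  LinearMap.mk₂ ℝ (bform M)
    (fun v v' u => by
      simp only [bform, Pi.add_apply, add_mul, Finset.sum_add_distrib])
    (fun c v u => by
      simp only [bform, Pi.smul_apply, smul_eq_mul, mul_assoc, Finset.mul_sum])
    (fun v u u' => by
      simp only [bform, Pi.add_apply, mul_add, add_mul, Finset.sum_add_distrib])
    (fun c v u => by
      simp only [bform, Pi.smul_apply, smul_eq_mul, Finset.mul_sum]
      exact Finset.sum_congr rfl fun _ _ => Finset.sum_congr rfl fun _ _ => by ring)

lemma form_apply (v u : S → ℝ) : form M v u = bform M v u := rfl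

lemma form_comm (v u : S → ℝ) : form M v u = form M u v := by
  simp only [form_apply, bform]
  rw [Finset.sum_comm]
  refine Finset.sum_congr rfl fun s _ => Finset.sum_congr rfl fun t _ => ?_
  rw [M.symmetric s t]; ring

variable [DecidableEq S]

lemma form_simpleRoot (s t : S) : form M (simpleRoot s) (simpleRoot t) = formCoeff M s t := by
  simp only [form_apply, bform, simpleRoot, formCoeff]
  rw [Finset.sum_eq_single s, Finset.sum_eq_single t]
  · simp
  · intro u _ hu; simp [hu]
  · simp
  · intro u _ hu; simp [hu]
  · simp

lemma form_simpleRoot_self (s : S) : form M (simpleRoot s) (simpleRoot s) = 1 := by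
  rw [form_simpleRoot, formCoeff_self]

lemma sum_smul_simpleRoot (v : S → ℝ) : ∑ s, v s • simpleRoot s = v := by
  ext t
  simp [simpleRoot, Finset.sum_apply, Pi.single_apply]

end Form

section Chebyshev

/-- The rescaled Chebyshev sequence `U 0 = 0`, `U 1 = 1`, `U (k+2) = κ U (k+1) - U k`. -/
def cheb (κ : ℝ) : ℕ → ℝ
  | 0 => 0
  | 1 => 1
  | k + 2 => κ * cheb κ (k + 1) - cheb κ k

lemma sin_mul_cheb (θ : ℝ) : ∀ k : ℕ, Real.sin θ * cheb (2 * Real.cos θ) k = Real.sin (k * θ)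
  | 0 => by simp [cheb]
  | 1 => by simp [cheb]
  | k + 2 => by
    have h1 := sin_mul_cheb θ (k + 1)
    have h0 := sin_mul_cheb θ k
    simp only [cheb]
    have e : Real.sin θ * (2 * Real.cos θ * cheb (2 * Real.cos θ) (k + 1) -
        cheb (2 * Real.cos θ) k) = 2 * Real.cos θ * Real.sin ((k + 1 : ℕ) * θ) -
          Real.sin (k * θ) := by
      rw [← h1, ← h0]; ring
    rw [e]
    have a1 : ((k + 2 : ℕ) : ℝ) * θ = ((k + 1 : ℕ) : ℝ) * θ + θ := by push_cast; ring
    have a2 : (k : ℝ) * θ = ((k + 1 : ℕ) : ℝ) * θ - θ := by push_cast; ring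
    rw [a1, a2, Real.sin_add, Real.sin_sub]; ring

lemma cheb_two : ∀ k : ℕ, cheb 2 k = k
  | 0 => by simp [cheb]
  | 1 => by simp [cheb]
  | k + 2 => by
    simp only [cheb, cheb_two (k + 1), cheb_two k]; push_cast; ring

lemma cheb_nonneg_of_le {m : ℕ} (hm : 2 ≤ m) {k : ℕ} (hk : k ≤ m) :
    0 ≤ cheb (2 * Real.cos (Real.pi / m)) k := by
  have hm' : (2 : ℝ) ≤ m := by exact_mod_cast hm
  have hs : 0 < Real.sin (Real.pi / m) := by
    apply Real.sin_pos_of_pos_of_lt_pi (by positivity)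
    rw [div_lt_iff₀ (by linarith)]; nlinarith [Real.pi_pos]
  have h2 : 0 ≤ Real.sin (k * (Real.pi / m)) := by
    apply Real.sin_nonneg_of_nonneg_of_le_pi (by positivity)
    have : (k : ℝ) ≤ m := by exact_mod_cast hk
    rw [mul_div_assoc', div_le_iff₀ (by linarith)]; nlinarith [Real.pi_pos]
  rw [← sin_mul_cheb] at h2
  exact nonneg_of_mul_nonneg_right h2 hs

end Chebyshev

section Tits

variable {S : Type*} [Fintype S] [DecidableEq S] {M : CoxeterMatrix S} {W : Type*} [Group W]
  (cs : CoxeterSystem M W) (ρ : W →* ((S → ℝ) ≃ₗ[ℝ] (S → ℝ)))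
  (hρ : ∀ (s : S) (v : S → ℝ), ρ (cs.simple s) v = refl (form M) (simpleRoot s) v)

open CoxeterSystem

include hρ in
lemma map_alternatingWord_simpleRoot (s t : S) (k : ℕ) :
    ρ (cs.wordProd (alternatingWord s t k)) (simpleRoot s) =
      if Even k then cheb (-2 * formCoeff M s t) (k + 1) • simpleRoot s +
        cheb (-2 * formCoeff M s t) k • simpleRoot t
      else cheb (-2 * formCoeff M s t) k • simpleRoot s +
        cheb (-2 * formCoeff M s t) (k + 1) • simpleRoot t := by
  induction k with
  | zero => simp [alternatingWord, cheb]
  | succ k ih =>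
    rw [alternatingWord_succ', wordProd_cons, map_mul, LinearEquiv.mul_apply, ih]
    by_cases hk : Even k
    · have hk' : ¬ Even (k + 1) := by simpa [Nat.even_add_one] using hk
      simp only [if_pos hk, if_neg hk', hρ, refl_apply, map_add, map_smul, form_simpleRoot,
        formCoeff_self, formCoeff_comm M t s, cheb]
      module
    · have hk' : Even (k + 1) := by simpa [Nat.even_add_one] using hk
      simp only [if_neg hk, if_pos hk', hρ, refl_apply, map_add, map_smul, form_simpleRoot,
        formCoeff_self, cheb]
      module

omit [Fintype S] [DecidableEq S] in
lemma exists_alternating_factor_of_succ {w : W} {s t : S} {k : ℕ}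
    (h : ∃ v, w = v * cs.wordProd (alternatingWord s t (k + 1)) ∧
      cs.length v + (k + 1) = cs.length w) :
    ∃ v, w = v * cs.wordProd (alternatingWord s t k) ∧ cs.length v + k = cs.length w := by
  obtain ⟨v, hv, hl⟩ := h
  rw [alternatingWord_succ', wordProd_cons, ← mul_assoc] at hv
  refine ⟨_, hv, ?_⟩
  have h1 := cs.length_mul_le (v * cs.simple (if Even k then t else s))
    (cs.wordProd (alternatingWord s t k))
  have h2 := cs.length_wordProd_le (alternatingWord s t k)
  rw [length_alternatingWord] at h2
  rw [← hv] at h1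
  rcases cs.length_mul_simple v (if Even k then t else s) with h | h <;> omega

include hρ in
/-- If `w s` is longer than `w`, then `w α_s` is a nonnegative vector. -/
theorem nonneg_of_not_isRightDescent (w : W) (s : S) (hs : ¬ cs.IsRightDescent w s) (i : S) :
    0 ≤ ρ w (simpleRoot s) i := by
  induction hn : cs.length w using Nat.strong_induction_on generalizing w s i with
  | _ n IH =>
  have hsimple : ∀ s i : S, (0 : ℝ) ≤ simpleRoot s i := fun s i => by
    simp only [simpleRoot, Pi.single_apply]; split_ifs <;> norm_num
  by_cases hw : w = 1
  · subst hw; simpa using hsimple s i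
  obtain ⟨t, ht⟩ := cs.exists_rightDescent_of_ne_one hw
  have hst : s ≠ t := fun h => hs (h ▸ ht)
  let Q : ℕ → Prop := fun k =>
    ∃ v, w = v * cs.wordProd (alternatingWord s t k) ∧ cs.length v + k = cs.length w
  have hQdown : ∀ {a b}, a ≤ b → Q b → Q a := fun {a b} hab => by
    induction hab with
    | refl => exact id
    | step _ ih => exact fun h => ih (exists_alternating_factor_of_succ cs h)
  have hQ1 : Q 1 := by
    refine ⟨w * cs.simple t, by simp [alternatingWord], ?_⟩
    exact (cs.isRightDescent_iff).1 ht
  have hQbig : ∃ k, ¬ Q k := ⟨cs.length w + 1, fun ⟨v, _, h⟩ => by omega⟩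
  classical
  obtain ⟨k, hQk, hQk1⟩ : ∃ k, Q (k + 1) ∧ ¬ Q (k + 2) := by
    have h0 := Nat.find_spec hQbig
    have h1 : ∀ j, j < Nat.find hQbig → Q j := fun j hj => not_not.1 (Nat.find_min hQbig hj)
    rcases hj : Nat.find hQbig with _ | _ | j
    · rw [hj] at h0; exact (h0 (hQdown (by omega) hQ1)).elim
    · rw [hj] at h0; exact (h0 hQ1).elim
    · rw [hj] at h0 h1; exact ⟨j, h1 _ (by omega), h0⟩
  have hkm : M s t ≠ 0 → k + 1 < M s t := by
    intro hm
    by_contra! hcon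
    obtain ⟨v, hv, hl⟩ := hQdown hcon hQk
    obtain ⟨m, hm'⟩ := Nat.exists_eq_succ_of_ne_zero hm
    have hbr := cs.wordProd_braidWord_eq s t
    simp only [braidWord, M.symmetric t s] at hbr
    rw [hbr, hm', alternatingWord_succ, List.concat_eq_append, wordProd_append,
      wordProd_singleton, ← mul_assoc] at hv
    apply hs
    have h2 := cs.length_mul_le v (cs.wordProd (alternatingWord s t m))
    have h3 := cs.length_wordProd_le (alternatingWord s t m)
    rw [length_alternatingWord] at h3
    have h4 : w * cs.simple s = v * cs.wordProd (alternatingWord s t m) := by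
      rw [hv, mul_assoc, simple_mul_simple_self, mul_one]
    unfold IsRightDescent
    rw [h4]
    omega
  obtain ⟨v, hv, hl⟩ := hQk
  have hnext : ¬ cs.IsRightDescent v (if Even (k + 1) then t else s) := by
    intro hd
    apply hQk1
    have := (cs.isRightDescent_iff).1 hd
    refine ⟨v * cs.simple (if Even (k + 1) then t else s), ?_, by omega⟩
    rw [alternatingWord_succ' s t (k + 1), wordProd_cons, ← mul_assoc, mul_assoc v,
      simple_mul_simple_self, mul_one]
    exact hv
  have hlast : ¬ cs.IsRightDescent v (if Even k then t else s) := by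
    intro hd
    have := (cs.isRightDescent_iff).1 hd
    rw [alternatingWord_succ', wordProd_cons, ← mul_assoc] at hv
    have h1 := cs.length_mul_le (v * cs.simple (if Even k then t else s))
      (cs.wordProd (alternatingWord s t k))
    have h2 := cs.length_wordProd_le (alternatingWord s t k)
    rw [length_alternatingWord] at h2
    rw [← hv] at h1
    omega
  have hboth : ¬ cs.IsRightDescent v s ∧ ¬ cs.IsRightDescent v t := by
    by_cases hk : Even k
    · have hk' : ¬ Even (k + 1) := by simpa [Nat.even_add_one] using hk
      rw [if_neg hk'] at hnext; rw [if_pos hk] at hlast; exact ⟨hnext, hlast⟩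
    · have hk' : Even (k + 1) := by simpa [Nat.even_add_one] using hk
      rw [if_pos hk'] at hnext; rw [if_neg hk] at hlast; exact ⟨hlast, hnext⟩
  have hvs := IH _ (by omega) v s hboth.1 i rfl
  have hvt := IH _ (by omega) v t hboth.2 i rfl
  have hU : 0 ≤ cheb (-2 * formCoeff M s t) (k + 1) ∧
      0 ≤ cheb (-2 * formCoeff M s t) (k + 2) := by
    unfold formCoeff
    split_ifs with h0
    · norm_num [cheb_two]; constructor <;> positivity
    · have h1 := hkm h0
      have h2 : M s t ≠ 1 := M.off_diagonal s t hst
      rw [show -2 * -Real.cos (Real.pi / (M s t : ℝ)) = 2 * Real.cos (Real.pi / (M s t : ℝ)) by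
        ring]
      exact ⟨cheb_nonneg_of_le (by omega) (by omega), cheb_nonneg_of_le (by omega) (by omega)⟩
  rw [hv, map_mul, LinearEquiv.mul_apply, map_alternatingWord_simpleRoot cs ρ hρ]
  split_ifs <;> simp only [map_add, map_smul, Pi.add_apply, Pi.smul_apply, smul_eq_mul] <;>
    [exact add_nonneg (mul_nonneg hU.2 hvs) (mul_nonneg hU.1 hvt);
     exact add_nonneg (mul_nonneg hU.1 hvs) (mul_nonneg hU.2 hvt)]

end Tits

end CoxeterSmall

namespace CoxeterSmall

/-- A root system with a height functional separating positive from negative roots. -/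
structure RootSys (V : Type*) [AddCommGroup V] [Module ℝ V] where
  /-- the invariant form -/
  B : LinearMap.BilinForm ℝ V
  /-- the group -/
  G : Subgroup (V ≃ₗ[ℝ] V)
  /-- the roots -/
  Φ : Set V
  /-- the functional whose sign is the sign of a root -/
  ht : V →ₗ[ℝ] ℝ
  symm : ∀ x y, B x y = B y x
  form_map : ∀ g ∈ G, ∀ x y, B (g x) (g y) = B x y
  map_mem : ∀ g ∈ G, ∀ β ∈ Φ, g β ∈ Φ
  norm : ∀ β ∈ Φ, B β β = 1
  exists_refl : ∀ β ∈ Φ, ∃ g ∈ G, ∀ v, g v = refl B β v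
  ht_ne_zero : ∀ β ∈ Φ, ht β ≠ 0
  finite_inv : ∀ g ∈ G, {β | β ∈ Φ ∧ 0 < ht β ∧ ht (g β) < 0}.Finite

section Geometric

variable {S : Type*} [Fintype S] [DecidableEq S] {M : CoxeterMatrix S} {W : Type*} [Group W]
  (cs : CoxeterSystem M W) (ρ : W →* ((S → ℝ) ≃ₗ[ℝ] (S → ℝ)))
  (hρ : ∀ (s : S) (v : S → ℝ), ρ (cs.simple s) v = refl (form M) (simpleRoot s) v)

open CoxeterSystem

/-- The sum of the coordinates. -/
noncomputable def coordSum (S : Type*) [Fintype S] : (S → ℝ) →ₗ[ℝ] ℝ := ∑ s, LinearMap.proj s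

omit [DecidableEq S] in
lemma coordSum_apply (v : S → ℝ) : coordSum S v = ∑ s, v s := by simp [coordSum]

include hρ

lemma form_map_map (w : W) (x y : S → ℝ) : form M (ρ w x) (ρ w y) = form M x y := by
  induction w using cs.simple_induction_left generalizing x y with
  | one => simp
  | mul_simple_left w s ih =>
    rw [map_mul, LinearEquiv.mul_apply, LinearEquiv.mul_apply, hρ, hρ,
      form_refl_refl (form_comm M) (form_simpleRoot_self M s), ih]

lemma form_root_self {β : S → ℝ} (hβ : β ∈ rootSet ρ) : form M β β = 1 := by
  obtain ⟨w, s, rfl⟩ := hβ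
  rw [form_map_map cs ρ hρ, form_simpleRoot_self]

lemma root_nonneg_or_nonpos {β : S → ℝ} (hβ : β ∈ rootSet ρ) :
    (∀ i, 0 ≤ β i) ∨ ∀ i, β i ≤ 0 := by
  obtain ⟨w, s, rfl⟩ := hβ
  by_cases h : cs.IsRightDescent w s
  · right
    intro i
    have h' : ¬ cs.IsRightDescent (w * cs.simple s) s := by
      unfold IsRightDescent at h ⊢
      rw [mul_assoc, simple_mul_simple_self, mul_one]; omega
    have := nonneg_of_not_isRightDescent cs ρ hρ _ s h' i
    rw [map_mul, LinearEquiv.mul_apply, hρ, refl_self (form_simpleRoot_self M s), map_neg] at this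
    simpa using this
  · exact .inl fun i => nonneg_of_not_isRightDescent cs ρ hρ w s h i

lemma exists_root_refl {β : S → ℝ} (hβ : β ∈ rootSet ρ) :
    ∃ t : W, ∀ v, ρ t v = refl (form M) β v := by
  obtain ⟨w, s, rfl⟩ := hβ
  refine ⟨w * cs.simple s * w⁻¹, fun v => ?_⟩
  have h : ρ w (ρ w⁻¹ v) = v := by
    rw [← LinearEquiv.mul_apply, ← map_mul]; simp
  rw [map_mul, map_mul, LinearEquiv.mul_apply, LinearEquiv.mul_apply, hρ]
  have := map_refl (B := form M) (B' := form M) (ρ w).toLinearMap (form_map_map cs ρ hρ w)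
    (simpleRoot s) (ρ w⁻¹ v)
  simpa [h] using this

lemma root_ne_zero {β : S → ℝ} (hβ : β ∈ rootSet ρ) : β ≠ 0 := fun h => by
  have := form_root_self cs ρ hρ hβ
  simp [h] at this

lemma coordSum_pos_iff {β : S → ℝ} (hβ : β ∈ rootSet ρ) : 0 < coordSum S β ↔ ∀ i, 0 ≤ β i := by
  rw [coordSum_apply]
  refine ⟨fun h => ?_, fun h => ?_⟩
  · rcases root_nonneg_or_nonpos cs ρ hρ hβ with h' | h'
    · exact h'
    · exact absurd (Finset.sum_nonpos fun i _ => h' i) (not_le.2 h)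
  · refine lt_of_le_of_ne (Finset.sum_nonneg fun i _ => h i) fun h0 => ?_
    refine root_ne_zero cs ρ hρ hβ (funext fun i => ?_)
    exact (Finset.sum_eq_zero_iff_of_nonneg fun i _ => h i).1 h0.symm i (Finset.mem_univ i)

omit [Fintype S] hρ in
lemma neg_mem_rootSet_of_refl {β : S → ℝ} (hβ : β ∈ rootSet ρ) {t : W}
    (ht : ρ t β = -β) : -β ∈ rootSet ρ := by
  obtain ⟨w, s, rfl⟩ := hβ
  exact ⟨t * w, s, by rw [map_mul, LinearEquiv.mul_apply, ht]⟩

lemma neg_mem_rootSet {β : S → ℝ} (hβ : β ∈ rootSet ρ) : -β ∈ rootSet ρ := by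
  obtain ⟨t, ht⟩ := exists_root_refl cs ρ hρ hβ
  exact neg_mem_rootSet_of_refl ρ hβ (by rw [ht, refl_self (form_root_self cs ρ hρ hβ)])

lemma coordSum_neg_iff {β : S → ℝ} (hβ : β ∈ rootSet ρ) : coordSum S β < 0 ↔ ∀ i, β i ≤ 0 := by
  have := coordSum_pos_iff cs ρ hρ (neg_mem_rootSet cs ρ hρ hβ)
  simpa using this

lemma coordSum_ne_zero {β : S → ℝ} (hβ : β ∈ rootSet ρ) : coordSum S β ≠ 0 := by
  rcases root_nonneg_or_nonpos cs ρ hρ hβ with h | h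
  · exact ((coordSum_pos_iff cs ρ hρ hβ).2 h).ne'
  · exact ((coordSum_neg_iff cs ρ hρ hβ).2 h).ne

omit [Fintype S] hρ in
lemma map_mem_rootSet (w : W) {β : S → ℝ} (hβ : β ∈ rootSet ρ) : ρ w β ∈ rootSet ρ := by
  obtain ⟨v, s, rfl⟩ := hβ
  exact ⟨w * v, s, by rw [map_mul, LinearEquiv.mul_apply]⟩

lemma eq_simpleRoot_of_neg {β : S → ℝ} (hβ : β ∈ rootSet ρ) (hpos : 0 < coordSum S β) (s : S)
    (hneg : coordSum S (ρ (cs.simple s) β) < 0) : β = simpleRoot s := by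
  rw [coordSum_pos_iff cs ρ hρ hβ] at hpos
  rw [coordSum_neg_iff cs ρ hρ (map_mem_rootSet ρ _ hβ)] at hneg
  have hz : ∀ i, i ≠ s → β i = 0 := fun i hi => by
    have h := hneg i
    rw [hρ, refl_apply] at h
    simp only [simpleRoot, Pi.sub_apply, Pi.smul_apply, Pi.single_apply, if_neg hi, smul_eq_mul,
      mul_zero, sub_zero] at h
    exact le_antisymm h (hpos i)
  have he : β = β s • simpleRoot s := by
    ext i
    by_cases hi : i = s
    · subst hi; simp [simpleRoot]
    · simp [simpleRoot, hz i hi, hi]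
  have hn := form_root_self cs ρ hρ hβ
  rw [he] at hn
  simp only [map_smul, LinearMap.smul_apply, form_simpleRoot_self, smul_eq_mul, mul_one] at hn
  have : β s = 1 := by nlinarith [hpos s]
  rw [he, this, one_smul]

lemma finite_inversions (w : W) :
    {β | β ∈ rootSet ρ ∧ 0 < coordSum S β ∧ coordSum S (ρ w β) < 0}.Finite := by
  induction w using cs.simple_induction_right with
  | one =>
    convert Set.finite_empty
    ext β
    simp only [map_one, LinearEquiv.coe_one, id, Set.mem_ofPred_eq, Set.mem_empty_iff_false,
      iff_false]
    rintro ⟨_, h1, h2⟩; linarith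
  | mul_simple_right w s ih =>
    refine ((ih.image (ρ (cs.simple s))).insert (simpleRoot s)).subset ?_
    rintro β ⟨hβ, hpos, hneg⟩
    rw [map_mul, LinearEquiv.mul_apply] at hneg
    rcases lt_or_ge 0 (coordSum S (ρ (cs.simple s) β)) with h | h
    · refine .inr ⟨ρ (cs.simple s) β, ⟨map_mem_rootSet ρ _ hβ, h, hneg⟩, ?_⟩
      rw [← LinearEquiv.mul_apply, ← map_mul, simple_mul_simple_self]; simp
    · exact .inl (eq_simpleRoot_of_neg cs ρ hρ hβ hpos s
        (lt_of_le_of_ne h (coordSum_ne_zero cs ρ hρ (map_mem_rootSet ρ _ hβ))))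

omit hρ in
/-- The root system of the geometric representation. -/
noncomputable def rootSys
    (hρ : ∀ (s : S) (v : S → ℝ), ρ (cs.simple s) v = refl (form M) (simpleRoot s) v) :
    RootSys (S → ℝ) where
  B := form M
  G := ρ.range
  Φ := rootSet ρ
  ht := coordSum S
  symm := form_comm M
  form_map := by rintro _ ⟨w, rfl⟩ x y; exact form_map_map cs ρ hρ w x y
  map_mem := by rintro _ ⟨w, rfl⟩ β hβ; exact map_mem_rootSet ρ w hβ
  norm := fun β hβ => form_root_self cs ρ hρ hβ
  exists_refl := fun β hβ => by
    obtain ⟨t, ht⟩ := exists_root_refl cs ρ hρ hβ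
    exact ⟨_, ⟨t, rfl⟩, ht⟩
  ht_ne_zero := fun β hβ => coordSum_ne_zero cs ρ hρ hβ
  finite_inv := by rintro _ ⟨w, rfl⟩; exact finite_inversions cs ρ hρ w

omit hρ in
lemma mem_coneOf_simple {v : S → ℝ} :
    v ∈ coneOf (Set.range (simpleRoot (S := S))) ↔ ∀ i, 0 ≤ v i := by
  constructor
  · rintro ⟨n, c, x, hc, hx, rfl⟩ i
    rw [Finset.sum_apply]
    refine Finset.sum_nonneg fun j _ => ?_
    obtain ⟨s, hs⟩ := hx j
    rw [← hs]
    simp only [simpleRoot, Pi.smul_apply, Pi.single_apply, smul_eq_mul]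
    exact mul_nonneg (hc j) (by split_ifs <;> norm_num)
  · intro h
    let e := Fintype.equivFin S
    refine ⟨Fintype.card S, fun j => v (e.symm j), fun j => simpleRoot (e.symm j),
      fun j => h _, fun j => ⟨_, rfl⟩, ?_⟩
    rw [Equiv.sum_comp e.symm (fun s => v s • simpleRoot s), sum_smul_simpleRoot]

lemma mem_posRoots {β : S → ℝ} : β ∈ posRoots ρ ↔ β ∈ rootSet ρ ∧ 0 < coordSum S β := by
  simp only [posRoots, Set.mem_inter_iff, mem_coneOf_simple]
  constructor
  · rintro ⟨h1, h2⟩; exact ⟨h2, (coordSum_pos_iff cs ρ hρ h2).2 h1⟩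
  · rintro ⟨h1, h2⟩; exact ⟨(coordSum_pos_iff cs ρ hρ h1).1 h2, h1⟩

lemma mem_negRoots {β : S → ℝ} : β ∈ negRoots ρ ↔ β ∈ rootSet ρ ∧ coordSum S β < 0 := by
  simp only [negRoots, Set.mem_ofPred_eq, mem_posRoots cs ρ hρ, map_neg, Left.neg_pos_iff]
  constructor
  · rintro ⟨h1, h2⟩; exact ⟨by simpa using neg_mem_rootSet cs ρ hρ h1, h2⟩
  · rintro ⟨h1, h2⟩; exact ⟨neg_mem_rootSet cs ρ hρ h1, h2⟩

end Geometric

section GeometricRepresentation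

variable {V : Type*} [AddCommGroup V] [Module ℝ V] {B : LinearMap.BilinForm ℝ V}

/-- Two unit vectors with `B a b = -cos θ` span a plane with an orthonormal basis in which they
lie at angles `0` and `π - θ`. -/
lemma exists_orthonorm (hB : ∀ x y, B x y = B y x) {a b : V} (ha : B a a = 1) (hb : B b b = 1)
    {θ : ℝ} (hθ : Real.sin θ ≠ 0) (hab : B a b = -Real.cos θ) :
    ∃ n, Orthonorm B a n ∧ b = circ a n (Real.pi - θ) ∧
      n = (Real.sin θ)⁻¹ • (b + Real.cos θ • a) := by
  refine ⟨_, ⟨ha, ?_, ?_, ?_⟩, ?_, rfl⟩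
  · simp only [map_add, map_smul, LinearMap.add_apply, LinearMap.smul_apply, smul_eq_mul, ha, hb,
      hab, hB b a]
    field_simp
    nlinarith [Real.sin_sq_add_cos_sq θ]
  · simp [ha, hab]
  · simp [ha, hab, hB b a]
  · simp only [circ, Real.cos_pi_sub, Real.sin_pi_sub, smul_smul, mul_inv_cancel₀ hθ]
    module

lemma refl_comp_circ {a n : V} (h : Orthonorm B a n) (θ φ : ℝ) :
    refl B a (refl B (circ a n (Real.pi - θ)) (circ a n φ)) = circ a n (φ + 2 * θ) := by
  rw [h.refl_circ]
  have := h.refl_circ 0 (2 * (Real.pi - θ) - φ + Real.pi)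
  rw [circ_zero] at this
  rw [this, ← circ_add_two_pi]
  congr 1; ring

lemma refl_comp_iterate_circ {a n : V} (h : Orthonorm B a n) (θ φ : ℝ) (k : ℕ) :
    ((refl B a * refl B (circ a n (Real.pi - θ))) ^ k) (circ a n φ) =
      circ a n (φ + k * (2 * θ)) := by
  induction k with
  | zero => simp
  | succ k ih =>
    rw [pow_succ', Module.End.mul_apply, ih, Module.End.mul_apply, refl_comp_circ h]
    congr 1; push_cast; ring

lemma refl_mul_refl_pow_eq_one (hB : ∀ x y, B x y = B y x) {a b : V} (ha : B a a = 1)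
    (hb : B b b = 1) {m : ℕ} (hm : 2 ≤ m) (hab : B a b = -Real.cos (Real.pi / m)) :
    (refl B a * refl B b) ^ m = 1 := by
  have hm' : (2 : ℝ) ≤ m := by exact_mod_cast hm
  have hs : 0 < Real.sin (Real.pi / m) := by
    apply Real.sin_pos_of_pos_of_lt_pi (by positivity)
    rw [div_lt_iff₀ (by linarith)]; nlinarith [Real.pi_pos]
  set θ := Real.pi / m with hθ
  have hmθ : m * θ = Real.pi := by rw [hθ]; field_simp
  obtain ⟨n, hn, hbn, hnb⟩ := exists_orthonorm hB ha hb hs.ne' hab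
  have hcirc : ∀ φ, ((refl B a * refl B b) ^ m) (circ a n φ) = circ a n φ := fun φ => by
    rw [hbn, refl_comp_iterate_circ hn, show φ + m * (2 * θ) = φ + 2 * Real.pi by
      rw [← hmθ]; ring, circ_add_two_pi]
  have hfix : ∀ v, B a v = 0 → B n v = 0 → ∀ k, ((refl B a * refl B b) ^ k) v = v := by
    intro v h1 h2 k
    have h3 : B b v = 0 := by
      rw [hbn]; simp [circ, h1, h2]
    induction k with
    | zero => simp
    | succ k ih => rw [pow_succ', Module.End.mul_apply, ih]; simp [refl_apply, h1, h3]
  ext v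
  set p := B a v
  set q := B n v
  have hv : v = (v - p • a - q • n) + p • circ a n 0 + q • circ a n (Real.pi / 2) := by
    simp only [circ, Real.cos_zero, Real.sin_zero, Real.cos_pi_div_two, Real.sin_pi_div_two]
    module
  have h0 := hfix (v - p • a - q • n) (by simp [hn.left, hn.ortho, p])
    (by simp [hn.right, hn.ortho', q]) m
  rw [Module.End.one_apply]
  conv_lhs => rw [hv]
  rw [map_add, map_add, map_smul, map_smul, hcirc, hcirc, h0, ← hv]

variable {S : Type*} [Fintype S] [DecidableEq S] (M : CoxeterMatrix S)

/-- The simple reflection as a linear equivalence. -/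
noncomputable def simpleRefl (s : S) : (S → ℝ) ≃ₗ[ℝ] (S → ℝ) :=
  LinearEquiv.ofInvolutive (refl (form M) (simpleRoot s))
    (refl_refl (form_simpleRoot_self M s))

lemma simpleRefl_isLiftable : M.IsLiftable (simpleRefl M) := by
  intro s t
  apply LinearEquiv.toLinearMap_injective
  have key : ((simpleRefl M s * simpleRefl M t) ^ M s t : (S → ℝ) ≃ₗ[ℝ] (S → ℝ)).toLinearMap =
      (refl (form M) (simpleRoot s) * refl (form M) (simpleRoot t)) ^ M s t := by
    generalize M s t = k
    induction k with
    | zero => rfl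
    | succ k ih =>
      rw [pow_succ', pow_succ', ← ih]; rfl
  rw [key]
  change _ = 1
  by_cases hst : s = t
  · subst hst
    rw [M.diagonal, pow_one]
    exact LinearMap.ext fun v => refl_refl (form_simpleRoot_self M s) v
  by_cases h0 : M s t = 0
  · rw [h0, pow_zero]
  have h1 := M.off_diagonal s t hst
  refine refl_mul_refl_pow_eq_one (form_comm M) (form_simpleRoot_self M s)
    (form_simpleRoot_self M t) (by omega) ?_
  rw [form_simpleRoot, formCoeff, if_neg h0]

/-- The geometric representation of the Coxeter group of `M`. -/
noncomputable def geomRep : M.Group →* ((S → ℝ) ≃ₗ[ℝ] (S → ℝ)) :=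
  M.toCoxeterSystem.lift ⟨simpleRefl M, simpleRefl_isLiftable M⟩

lemma geomRep_simple (s : S) (v : S → ℝ) :
    geomRep M (M.toCoxeterSystem.simple s) v = refl (form M) (simpleRoot s) v := by
  rw [geomRep, CoxeterSystem.lift_apply_simple]; rfl

/-- Vectors with the Gram matrix of a Coxeter matrix generate under reflections only
combinations whose coefficients have a common sign. -/
theorem ReflClosure.exists_sign {e : S → V} (he : ∀ s t, B (e s) (e t) = formCoeff M s t) {x : V}
    (hx : ReflClosure B (Set.range e) x) :
    ∃ v : S → ℝ, x = ∑ s, v s • e s ∧ ((∀ s, 0 ≤ v s) ∨ ∀ s, v s ≤ 0) := by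
  let L : (S → ℝ) →ₗ[ℝ] V := Fintype.linearCombination ℝ e
  have hLs : ∀ s, L (simpleRoot s) = e s := fun s => by
    simp [L, simpleRoot, Fintype.linearCombination_apply_single]
  have hL : ∀ x y, B (L x) (L y) = form M x y := by
    intro x y
    rw [← sum_smul_simpleRoot x, ← sum_smul_simpleRoot y]
    simp only [map_sum, map_smul, hLs, LinearMap.sum_apply, LinearMap.smul_apply, he,
      form_simpleRoot]
  have hmem : ∃ v ∈ rootSet (geomRep M), x = L v := by
    induction hx with
    | base h =>
      obtain ⟨s, rfl⟩ := h
      exact ⟨simpleRoot s, ⟨1, s, by simp⟩, (hLs s).symm⟩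
    | refl _ _ h1 h2 =>
      obtain ⟨v, hv, rfl⟩ := h1
      obtain ⟨u, hu, rfl⟩ := h2
      obtain ⟨t, ht⟩ := exists_root_refl M.toCoxeterSystem (geomRep M) (geomRep_simple M) hv
      exact ⟨geomRep M t u, map_mem_rootSet _ t hu, by rw [ht, map_refl L hL]⟩
  obtain ⟨v, hv, rfl⟩ := hmem
  exact ⟨v, by simp [L, Fintype.linearCombination_apply],
    root_nonneg_or_nonpos M.toCoxeterSystem (geomRep M) (geomRep_simple M) hv⟩

end GeometricRepresentation

end CoxeterSmall

namespace CoxeterSmall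

section Recurrence

variable {E F : Type*} [AddCommGroup E] [Module ℝ E] [AddCommGroup F] [Module ℝ F]

/-- The sequence `a, b, 2xb - a, …` with `r (k+2) = 2x r (k+1) - r k`. -/
def chain (x : ℝ) (a b : E) : ℕ → E
  | 0 => a
  | 1 => b
  | k + 2 => (2 * x) • chain x a b (k + 1) - chain x a b k

lemma map_chain (f : E →ₗ[ℝ] F) (x : ℝ) (a b : E) :
    ∀ k, f (chain x a b k) = chain x (f a) (f b) k
  | 0 => rfl
  | 1 => rfl
  | k + 2 => by
    simp only [chain, map_sub, map_smul, map_chain f x a b (k + 1), map_chain f x a b k]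

lemma chain_strictMono {x : ℝ} (hx : 1 ≤ x) {a b : ℝ} (hab : a < b) (hb : 0 ≤ b) :
    StrictMono (chain x a b) := by
  have h : ∀ k, chain x a b k < chain x a b (k + 1) ∧ 0 ≤ chain x a b (k + 1) := by
    intro k
    induction k with
    | zero => exact ⟨hab, hb⟩
    | succ k ih =>
      have e : chain x a b (k + 1 + 1) = 2 * x * chain x a b (k + 1) - chain x a b k := rfl
      have h1 : 0 ≤ (x - 1) * chain x a b (k + 1) := mul_nonneg (by linarith) ih.2
      constructor <;> rw [e] <;> linarith [ih.1, ih.2]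
  exact strictMono_nat_of_lt_succ fun k => (h k).1

lemma chain_one (a b : E) : ∀ k : ℕ, chain 1 a b k = a + (k : ℝ) • (b - a)
  | 0 => by simp [chain]
  | 1 => by simp [chain]
  | k + 2 => by
    simp only [chain, chain_one a b (k + 1), chain_one a b k]; push_cast; module

/-- A positive sequence cannot satisfy `u (k+2) = 2x u (k+1) - u k` with `x < 1`. -/
lemma not_forall_pos_of_recurrence {x : ℝ} (hx : x < 1) {u : ℕ → ℝ}
    (hu : ∀ k, u (k + 2) = 2 * x * u (k + 1) - u k) (hpos : ∀ k, 0 < u k) : False := by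
  have hdec : ∀ k, u (k + 2) - u (k + 1) = u (k + 1) - u k - 2 * (1 - x) * u (k + 1) :=
    fun k => by rw [hu]; ring
  obtain ⟨N, hN⟩ : ∃ N, u (N + 1) < u N := by
    by_contra! hcon
    have hmono : ∀ k, u 0 ≤ u k := fun k => by
      induction k with
      | zero => exact le_rfl
      | succ k ih => exact ih.trans (hcon k)
    have hlin : ∀ k : ℕ, u (k + 1) - u k ≤ u 1 - u 0 - k * (2 * (1 - x) * u 0) := fun k => by
      induction k with
      | zero => simp
      | succ k ih =>
        have h1 := hdec k
        have h2 : 0 ≤ 2 * (1 - x) * (u (k + 1) - u 0) :=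
          mul_nonneg (by linarith) (by linarith [hmono (k + 1)])
        push_cast
        linarith
    have hc : 0 < 2 * (1 - x) * u 0 := mul_pos (by linarith) (hpos 0)
    obtain ⟨k, hk⟩ := exists_nat_gt ((u 1 - u 0) / (2 * (1 - x) * u 0))
    rw [div_lt_iff₀ hc] at hk
    linarith [hlin k, hcon k]
  have hstep : ∀ k, u (N + k + 1) - u (N + k) ≤ u (N + 1) - u N := fun k => by
    induction k with
    | zero => exact le_rfl
    | succ k ih =>
      have h1 := hdec (N + k)
      have h2 : 0 < 2 * (1 - x) * u (N + k + 1) := mul_pos (by linarith) (hpos _)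
      have e1 : N + (k + 1) + 1 = N + k + 2 := by ring
      have e2 : N + (k + 1) = N + k + 1 := by ring
      rw [e1, e2]; linarith
  have hlin : ∀ k : ℕ, u (N + k) ≤ u N + k * (u (N + 1) - u N) := fun k => by
    induction k with
    | zero => simp
    | succ k ih =>
      have h1 := hstep k
      have e2 : N + (k + 1) = N + k + 1 := by ring
      rw [e2]; push_cast; linarith
  have hc : 0 < u N - u (N + 1) := by linarith
  obtain ⟨k, hk⟩ := exists_nat_gt (u N / (u N - u (N + 1)))
  rw [div_lt_iff₀ hc] at hk
  linarith [hlin k, hpos (N + k)]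

end Recurrence

namespace RootSys

variable {V : Type*} [AddCommGroup V] [Module ℝ V] (R : RootSys V)

/-- The dominance order, `a ≼ b`. -/
def Dom (a b : V) : Prop := ∀ g ∈ R.G, R.ht (g b) < 0 → R.ht (g a) < 0

variable {R}

lemma refl_mem {α β : V} (hα : α ∈ R.Φ) (hβ : β ∈ R.Φ) : refl R.B α β ∈ R.Φ := by
  obtain ⟨g, hg, h⟩ := R.exists_refl α hα
  rw [← h]; exact R.map_mem g hg β hβ

lemma neg_mem {β : V} (hβ : β ∈ R.Φ) : -β ∈ R.Φ := by
  rw [← refl_self (R.norm β hβ)]; exact refl_mem hβ hβ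

lemma closure_mem {X : Set V} (hX : X ⊆ R.Φ) {v : V} (hv : ReflClosure R.B X v) : v ∈ R.Φ := by
  induction hv with
  | base h => exact hX h
  | refl _ _ h1 h2 => exact refl_mem h1 h2

lemma ht_map_ne {β : V} (hβ : β ∈ R.Φ) {g : V ≃ₗ[ℝ] V} (hg : g ∈ R.G) : R.ht (g β) ≠ 0 :=
  R.ht_ne_zero _ (R.map_mem g hg β hβ)

lemma Dom.trans {a b c : V} (h1 : R.Dom a b) (h2 : R.Dom b c) : R.Dom a c :=
  fun g hg h => h1 g hg (h2 g hg h)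

lemma Dom.map {a b : V} (h : R.Dom a b) {g : V ≃ₗ[ℝ] V} (hg : g ∈ R.G) :
    R.Dom (g a) (g b) :=
  fun g' hg' h' => h (g' * g) (R.G.mul_mem hg' hg) h'

lemma Dom.neg {a b : V} (hb : b ∈ R.Φ) (h : R.Dom a b) : R.Dom (-b) (-a) := by
  intro g hg hlt
  simp only [map_neg, Left.neg_neg_iff] at hlt ⊢
  rcases lt_or_gt_of_ne (ht_map_ne hb hg) with h' | h'
  · exact absurd (h g hg h') (not_lt.2 hlt.le)
  · exact h'

lemma Dom.neg_refl {α β : V} (hα : α ∈ R.Φ) (hβ : β ∈ R.Φ) (h : R.Dom α β) :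
    R.Dom (-refl R.B α β) α := by
  obtain ⟨g, hg, hgr⟩ := R.exists_refl α hα
  have h1 := (h.map hg).neg (R.map_mem g hg _ hβ)
  rwa [hgr, hgr, refl_self (R.norm α hα), neg_neg] at h1

lemma chain_mem {α β : V} (hα : α ∈ R.Φ) (hβ : β ∈ R.Φ) (k : ℕ) :
    chain (R.B α β) β α k ∈ R.Φ ∧ chain (R.B α β) β α (k + 1) ∈ R.Φ ∧
      R.B (chain (R.B α β) β α (k + 1)) (chain (R.B α β) β α k) = R.B α β := by
  induction k with
  | zero => exact ⟨hβ, hα, rfl⟩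
  | succ k ih =>
    obtain ⟨h1, h2, h3⟩ := ih
    have e : chain (R.B α β) β α (k + 1 + 1) =
        -refl R.B (chain (R.B α β) β α (k + 1)) (chain (R.B α β) β α k) := by
      rw [refl_apply, h3, neg_sub]; rfl
    refine ⟨h2, e ▸ neg_mem (refl_mem h2 h1), ?_⟩
    rw [e, refl_apply, h3]
    simp only [neg_sub, map_sub, map_smul, LinearMap.sub_apply, LinearMap.smul_apply,
      R.norm _ h2, R.symm (chain (R.B α β) β α k), h3, smul_eq_mul]
    ring

lemma Dom.chain_succ {α β : V} (hα : α ∈ R.Φ) (hβ : β ∈ R.Φ) (h : R.Dom α β) (k : ℕ) :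
    R.Dom (chain (R.B α β) β α (k + 1)) (chain (R.B α β) β α k) := by
  induction k with
  | zero => exact h
  | succ k ih =>
    obtain ⟨h1, h2, h3⟩ := chain_mem hα hβ k
    have := ih.neg_refl h2 h1
    rwa [refl_apply, h3, neg_sub] at this

lemma Dom.chain_zero {α β : V} (hα : α ∈ R.Φ) (hβ : β ∈ R.Φ) (h : R.Dom α β) (k : ℕ) :
    R.Dom (chain (R.B α β) β α k) β := by
  induction k with
  | zero => exact fun _ _ => id
  | succ k ih => exact (h.chain_succ hα hβ k).trans ih

/-- Comparable roots have form at least `1`. -/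
lemma Dom.one_le_form {α β : V} (hα : α ∈ R.Φ) (hβ : β ∈ R.Φ) (h : R.Dom α β) :
    1 ≤ R.B α β := by
  by_contra! hx
  set u : ℕ → ℝ := fun k => R.ht (chain (R.B α β) β α k) with hu
  have hrec : ∀ k, u (k + 2) = 2 * R.B α β * u (k + 1) - u k := fun k => by
    simp only [hu, chain, map_sub, map_smul, smul_eq_mul]
  have hne : ∀ k, u k ≠ 0 := fun k => R.ht_ne_zero _ (chain_mem hα hβ k).1
  by_cases hall : ∀ k, 0 < u k
  · exact not_forall_pos_of_recurrence hx hrec hall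
  · push Not at hall
    obtain ⟨N, hN⟩ := hall
    have hneg : ∀ k, u (N + k) < 0 := fun k => by
      induction k with
      | zero => exact lt_of_le_of_ne hN (hne N)
      | succ k ih => exact h.chain_succ hα hβ (N + k) 1 R.G.one_mem ih
    refine not_forall_pos_of_recurrence hx (u := fun k => -u (N + k)) (fun k => ?_)
      fun k => neg_pos.2 (hneg k)
    have := hrec (N + k)
    change -u (N + k + 2) = 2 * R.B α β * -u (N + k + 1) - -u (N + k)
    linarith

lemma chain_injective {α β : V} (hβ : β ∈ R.Φ) (hx : 1 ≤ R.B α β) (hne : α ≠ β) :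
    Function.Injective (chain (R.B α β) β α) := by
  rcases hx.lt_or_eq with hx' | hx'
  · have h1 : StrictMono (chain (R.B α β) 1 (R.B α β)) :=
      chain_strictMono hx hx' (by linarith)
    intro i j hij
    apply h1.injective
    have h2 := congrArg (R.B β) hij
    rwa [map_chain, map_chain, R.norm β hβ, R.symm β α] at h2
  · intro i j hij
    rw [← hx', chain_one, chain_one, add_right_inj] at hij
    exact_mod_cast smul_left_injective ℝ (sub_ne_zero.2 hne) hij

lemma exists_refl_neg {β : V} (hβ : β ∈ R.Φ) (hpos : 0 < R.ht β) :
    ∃ g ∈ R.G, (∀ v, g v = refl R.B β v) ∧ R.ht (g β) < 0 := by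
  obtain ⟨g, hg, h⟩ := R.exists_refl β hβ
  refine ⟨g, hg, h, ?_⟩
  rw [h, refl_self (R.norm β hβ), map_neg]; linarith

lemma Dom.ht_lt_of_pos {α β : V} (hα : α ∈ R.Φ) (hβ : β ∈ R.Φ) (h : R.Dom α β) (hne : α ≠ β)
    {l : ℝ} (hl : 0 < l) (hlx : l + l⁻¹ = 2 * R.B α β) (hpos : 0 < R.ht β) :
    R.ht α < l * R.ht β := by
  by_contra! hcon
  have hstep : ∀ k, 0 < chain (R.B α β) (R.ht β) (R.ht α) k ∧
      l * chain (R.B α β) (R.ht β) (R.ht α) k ≤ chain (R.B α β) (R.ht β) (R.ht α) (k + 1) := by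
    intro k
    induction k with
    | zero => exact ⟨hpos, hcon⟩
    | succ k ih =>
      have h1 : 0 < chain (R.B α β) (R.ht β) (R.ht α) (k + 1) :=
        lt_of_lt_of_le (mul_pos hl ih.1) ih.2
      refine ⟨h1, ?_⟩
      have e : chain (R.B α β) (R.ht β) (R.ht α) (k + 1 + 1) =
        2 * R.B α β * chain (R.B α β) (R.ht β) (R.ht α) (k + 1) -
          chain (R.B α β) (R.ht β) (R.ht α) k := rfl
      have h2 : l⁻¹ * (l * chain (R.B α β) (R.ht β) (R.ht α) k) ≤
          l⁻¹ * chain (R.B α β) (R.ht β) (R.ht α) (k + 1) :=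
        mul_le_mul_of_nonneg_left ih.2 (by positivity)
      rw [inv_mul_cancel_left₀ hl.ne'] at h2
      rw [e, ← hlx]
      linarith
  obtain ⟨g, hg, -, hgneg⟩ := exists_refl_neg hβ hpos
  refine Set.infinite_of_injective_forall_mem
    (chain_injective hβ (h.one_le_form hα hβ) hne) (fun k => ?_) (R.finite_inv g hg)
  refine ⟨(chain_mem hα hβ k).1, ?_, h.chain_zero hα hβ k g hg hgneg⟩
  rw [map_chain]; exact (hstep k).1

lemma Dom.ht_lt {α β : V} (hα : α ∈ R.Φ) (hβ : β ∈ R.Φ) (h : R.Dom α β) (hne : α ≠ β)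
    {l : ℝ} (hl : 0 < l) (hlx : l + l⁻¹ = 2 * R.B α β) : R.ht α < l * R.ht β := by
  rcases lt_or_gt_of_ne (R.ht_ne_zero β hβ) with hb | hb
  · have ha : R.ht α < 0 := h 1 R.G.one_mem hb
    have := (h.neg hβ).ht_lt_of_pos (neg_mem hβ) (neg_mem hα)
      (fun h' => hne (neg_injective h').symm) (inv_pos.2 hl)
      (by rw [inv_inv]; simp only [map_neg, LinearMap.neg_apply, neg_neg, R.symm β α]; linarith)
      (by rw [map_neg]; linarith)
    rw [map_neg, map_neg] at this
    have h2 := mul_lt_mul_of_pos_left this hl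
    rw [mul_neg, mul_neg, mul_neg, mul_inv_cancel_left₀ hl.ne'] at h2
    linarith
  · exact h.ht_lt_of_pos hα hβ hne hl hlx hb

lemma Dom.ht_map_lt {α β : V} (hα : α ∈ R.Φ) (hβ : β ∈ R.Φ) (h : R.Dom α β) (hne : α ≠ β)
    {l : ℝ} (hl : 0 < l) (hlx : l + l⁻¹ = 2 * R.B α β) {g : V ≃ₗ[ℝ] V} (hg : g ∈ R.G) :
    R.ht (g α) < l * R.ht (g β) :=
  (h.map hg).ht_lt (R.map_mem g hg _ hα) (R.map_mem g hg _ hβ) (fun h' => hne (g.injective h'))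
    hl (by rw [hlx, R.form_map g hg])

/-- Roots with form at least `1` are comparable. -/
lemma dom_or_dom {α β : V} (hα : α ∈ R.Φ) (hβ : β ∈ R.Φ) (hx : 1 ≤ R.B α β) :
    R.Dom α β ∨ R.Dom β α := by
  by_contra hcon
  simp only [not_or, Dom, not_forall, exists_prop, not_lt] at hcon
  obtain ⟨⟨w, hw, hw0, hw1⟩, ⟨w', hw', hw0', hw1'⟩⟩ := hcon
  have h1 := lt_of_le_of_ne hw1 (ht_map_ne hα hw).symm
  have h2 := lt_of_le_of_ne hw1' (ht_map_ne hβ hw').symm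
  have m1 : StrictMono (chain (R.B α β) (R.ht (w β)) (R.ht (w α))) :=
    chain_strictMono hx (by linarith) h1.le
  have m2 : StrictMono (chain (R.B α β) (-R.ht (w' β)) (-R.ht (w' α))) :=
    chain_strictMono hx (by linarith) (by linarith)
  have e1 : ∀ k, R.ht (w (chain (R.B α β) β α k)) =
      chain (R.B α β) (R.ht (w β)) (R.ht (w α)) k :=
    fun k => map_chain (R.ht ∘ₗ w.toLinearMap) _ _ _ k
  have e2 : ∀ k, -R.ht (w' (chain (R.B α β) β α k)) =
      chain (R.B α β) (-R.ht (w' β)) (-R.ht (w' α)) k :=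
    fun k => map_chain (-(R.ht ∘ₗ w'.toLinearMap)) _ _ _ k
  refine Set.infinite_of_injective_forall_mem (f := fun k => w (chain (R.B α β) β α (k + 1)))
    (fun i j hij => ?_) (fun k => ?_)
    (R.finite_inv (w' * w⁻¹) (R.G.mul_mem hw' (R.G.inv_mem hw)))
  · have h := congrArg R.ht hij
    simp only [e1] at h
    simpa using m1.injective h
  · refine ⟨R.map_mem w hw _ (chain_mem hα hβ _).1, ?_, ?_⟩
    · rw [e1]
      exact lt_of_lt_of_le h1 (m1.monotone (show 1 ≤ k + 1 by omega))
    · have h3 : (w' * w⁻¹) (w (chain (R.B α β) β α (k + 1))) =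
          w' (chain (R.B α β) β α (k + 1)) := by
        change w' (w.symm (w _)) = _
        rw [LinearEquiv.symm_apply_apply]
      rw [h3]
      have h4 := m2.monotone (show 1 ≤ k + 1 by omega)
      have h5 : chain (R.B α β) (-R.ht (w' β)) (-R.ht (w' α)) 1 = -R.ht (w' α) := rfl
      rw [h5, ← e2] at h4
      linarith

end RootSys

end CoxeterSmall

namespace CoxeterSmall

section Angles

/-- A set of reals closed under point reflections whose least positive element is `ψ` consists of
multiples of `ψ`. -/
lemma exists_int_mul_of_gap {A : Set ℝ} (h0 : 0 ∈ A) (hA : ∀ φ ∈ A, ∀ χ ∈ A, 2 * φ - χ ∈ A)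
    {ψ : ℝ} (hψ : ψ ∈ A) (hpos : 0 < ψ) (hgap : ∀ φ ∈ A, 0 < φ → ψ ≤ φ) {φ : ℝ} (hφ : φ ∈ A) :
    ∃ z : ℤ, φ = z * ψ := by
  have hneg : ∀ χ ∈ A, -χ ∈ A := fun χ hχ => by simpa using hA 0 h0 χ hχ
  have hadd : ∀ χ ∈ A, ∀ k : ℕ, χ + k * (2 * ψ) ∈ A := fun χ hχ k => by
    induction k with
    | zero => simpa using hχ
    | succ k ih =>
      have := hA ψ hψ _ (hneg _ ih)
      convert this using 1
      push_cast; ring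
  have hshift : ∀ χ ∈ A, ∀ z : ℤ, χ + z * (2 * ψ) ∈ A := fun χ hχ z => by
    obtain ⟨k, rfl | rfl⟩ := z.eq_nat_or_neg
    · simpa using hadd χ hχ k
    · have := hneg _ (hadd _ (hneg χ hχ) k)
      convert this using 1
      push_cast; ring
  set z := round (φ / (2 * ψ)) with hz
  have hmem := hshift φ hφ (-z)
  have habs : |φ + ((-z : ℤ) : ℝ) * (2 * ψ)| ≤ ψ := by
    have h1 := abs_sub_round (φ / (2 * ψ))
    have h2 : φ + ((-z : ℤ) : ℝ) * (2 * ψ) = (φ / (2 * ψ) - z) * (2 * ψ) := by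
      push_cast; field_simp; ring
    rw [h2, abs_mul, abs_of_pos (show 0 < 2 * ψ by linarith)]
    nlinarith
  have hcases : ∀ χ ∈ A, |χ| ≤ ψ → χ = 0 ∨ χ = ψ ∨ χ = -ψ := fun χ hχ hle => by
    rcases lt_trichotomy χ 0 with h | h | h
    · have := hgap _ (hneg χ hχ) (by linarith)
      rw [abs_of_neg h] at hle
      exact .inr (.inr (by linarith))
    · exact .inl h
    · have := hgap _ hχ h
      rw [abs_of_pos h] at hle
      exact .inr (.inl (by linarith))
  rcases hcases _ hmem habs with h | h | h
  · exact ⟨2 * z, by push_cast at h ⊢; linarith⟩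
  · exact ⟨2 * z + 1, by push_cast at h ⊢; linarith⟩
  · exact ⟨2 * z - 1, by push_cast at h ⊢; linarith⟩

variable {V : Type*} [AddCommGroup V] [Module ℝ V] {B : LinearMap.BilinForm ℝ V} {a n : V}

lemma Orthonorm.circ_two_mul_sub_mem (h : Orthonorm B a n) {Ψ : Set V}
    (hΨ : ∀ x ∈ Ψ, ∀ y ∈ Ψ, refl B x y ∈ Ψ) {φ χ : ℝ} (hφ : circ a n φ ∈ Ψ)
    (hχ : circ a n χ ∈ Ψ) : circ a n (2 * φ - χ) ∈ Ψ := by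
  have h1 := hΨ _ hφ _ hχ
  rw [h.refl_circ] at h1
  have h2 := hΨ _ h1 _ h1
  rw [h.refl_circ] at h2
  rw [← circ_add_two_pi]
  convert h2 using 2
  ring

lemma Orthonorm.exists_int_mul_of_gap (h : Orthonorm B a n) {Ψ : Set V}
    (hΨ : ∀ x ∈ Ψ, ∀ y ∈ Ψ, refl B x y ∈ Ψ) (ha : a ∈ Ψ) {ψ : ℝ} (hψ : circ a n ψ ∈ Ψ)
    (hpos : 0 < ψ) (hgap : ∀ φ, circ a n φ ∈ Ψ → 0 < φ → ψ ≤ φ) :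
    (∀ φ, circ a n φ ∈ Ψ → ∃ z : ℤ, φ = z * ψ) ∧ ∃ m : ℕ, Real.pi = m * ψ := by
  have h1 : ∀ φ, circ a n φ ∈ Ψ → ∃ z : ℤ, φ = z * ψ := fun φ hφ =>
    CoxeterSmall.exists_int_mul_of_gap (A := {φ | circ a n φ ∈ Ψ})
      (by simpa [circ_zero] using ha) (fun φ hφ χ hχ => h.circ_two_mul_sub_mem hΨ hφ hχ) hψ hpos
      hgap hφ
  refine ⟨h1, ?_⟩
  obtain ⟨z, hz⟩ := h1 Real.pi (by
    have := hΨ a ha a ha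
    rw [refl_self h.left, ← circ_zero a n, ← circ_add_pi, zero_add] at this
    exact this)
  have hz0 : 0 < (z : ℝ) := by
    by_contra! hcon
    nlinarith [Real.pi_pos]
  have hz1 : 0 ≤ z := by exact_mod_cast hz0.le
  lift z to ℕ using hz1
  exact ⟨z, by exact_mod_cast hz⟩

lemma Orthonorm.circ_nat_mul_mem (h : Orthonorm B a n) {Ψ : Set V}
    (hΨ : ∀ x ∈ Ψ, ∀ y ∈ Ψ, refl B x y ∈ Ψ) (ha : a ∈ Ψ) {ψ : ℝ} (hψ : circ a n ψ ∈ Ψ) (k : ℕ) :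
    circ a n (k * ψ) ∈ Ψ ∧ circ a n ((k + 1 : ℕ) * ψ) ∈ Ψ := by
  induction k with
  | zero => simpa [circ_zero] using ⟨ha, hψ⟩
  | succ k ih =>
    refine ⟨ih.2, ?_⟩
    have := h.circ_two_mul_sub_mem hΨ ih.2 ih.1
    convert this using 2
    push_cast; ring

end Angles

section Coefficients

lemma cheb_norm (κ : ℝ) (k : ℕ) :
    cheb κ (k + 1) ^ 2 + cheb κ k ^ 2 - κ * cheb κ (k + 1) * cheb κ k = 1 := by
  induction k with
  | zero => simp [cheb]
  | succ k ih =>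
    have e : cheb κ (k + 1 + 1) = κ * cheb κ (k + 1) - cheb κ k := rfl
    rw [e]; nlinarith

variable {m : ℕ} (hm : 3 ≤ m)
include hm

lemma sin_pi_div_pos : 0 < Real.sin (Real.pi / m) := by
  have hm' : (3 : ℝ) ≤ m := by exact_mod_cast hm
  apply Real.sin_pos_of_pos_of_lt_pi (by positivity)
  rw [div_lt_iff₀ (by linarith)]; nlinarith [Real.pi_pos]

lemma cheb_le_cheb {i j : ℕ} (hij : i ≤ j) (hj : j + i ≤ m) :
    cheb (2 * Real.cos (Real.pi / m)) i ≤ cheb (2 * Real.cos (Real.pi / m)) j := by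
  have hs := sin_pi_div_pos hm
  have hm' : (3 : ℝ) ≤ m := by exact_mod_cast hm
  set θ := Real.pi / m with hθ
  have hmθ : m * θ = Real.pi := by rw [hθ]; field_simp
  have hθ0 : 0 < θ := by positivity
  have hij' : (i : ℝ) ≤ j := by exact_mod_cast hij
  have hj' : (j : ℝ) + i ≤ m := by exact_mod_cast hj
  have h : Real.sin (i * θ) ≤ Real.sin (j * θ) := by
    rw [← sub_nonneg, Real.sin_sub_sin]
    refine mul_nonneg (mul_nonneg (by norm_num) ?_) ?_
    · apply Real.sin_nonneg_of_nonneg_of_le_pi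
      · nlinarith
      · nlinarith [(Nat.cast_nonneg i : (0 : ℝ) ≤ i)]
    · apply Real.cos_nonneg_of_neg_pi_div_two_le_of_le
      · have : 0 ≤ (j * θ + i * θ) / 2 := by positivity
        linarith [Real.pi_pos]
      · nlinarith
  rw [← sin_mul_cheb, ← sin_mul_cheb] at h
  exact le_of_mul_le_mul_left h hs

lemma cheb_sub {j : ℕ} (hj : j ≤ m) :
    cheb (2 * Real.cos (Real.pi / m)) (m - j) = cheb (2 * Real.cos (Real.pi / m)) j := by
  have hs := sin_pi_div_pos hm
  have hm' : (3 : ℝ) ≤ m := by exact_mod_cast hm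
  apply mul_left_cancel₀ hs.ne'
  rw [sin_mul_cheb, sin_mul_cheb, Nat.cast_sub hj, sub_mul,
    show (m : ℝ) * (Real.pi / m) = Real.pi by field_simp, Real.sin_pi_sub]

omit hm in
/-- The coefficients of a non-simple positive root in the dihedral root system of order `2m`. -/
def CoefPair (m : ℕ) (κ c c' : ℝ) : Prop :=
  3 ≤ m ∧ κ = 2 * Real.cos (Real.pi / m) ∧ ∃ i j : ℕ, 1 ≤ i ∧ 1 ≤ j ∧ i < m ∧ j < m ∧
    (i = j + 1 ∨ j = i + 1) ∧ c = cheb κ i ∧ c' = cheb κ j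

omit hm
variable {κ c c' : ℝ}

lemma CoefPair.symm (h : CoefPair m κ c c') : CoefPair m κ c' c := by
  obtain ⟨h1, h2, i, j, hi, hj, hi', hj', hij, hc, hc'⟩ := h
  exact ⟨h1, h2, j, i, hj, hi, hj', hi', hij.symm, hc', hc⟩

lemma CoefPair.norm (h : CoefPair m κ c c') : c ^ 2 + c' ^ 2 - κ * c * c' = 1 := by
  obtain ⟨-, -, i, j, -, -, -, -, rfl | rfl, rfl, rfl⟩ := h
  · exact cheb_norm κ j
  · linarith [cheb_norm κ i]

lemma CoefPair.one_le (h : CoefPair m κ c c') : 1 ≤ c := by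
  obtain ⟨hm, rfl, i, j, hi, -, hi', -, -, rfl, -⟩ := h
  exact cheb_le_cheb hm hi (by omega)

lemma CoefPair.eq_of_one (h : CoefPair m κ c c') (hc : c = 1) : c' = κ := by
  have h1 := h.norm
  have h2 := h.symm.one_le
  subst hc
  have : c' * (c' - κ) = 0 := by linarith
  rcases mul_eq_zero.1 this with h | h <;> linarith

lemma CoefPair.eq_one_or_le (h : CoefPair m κ c c') : c = 1 ∨ κ ≤ c := by
  obtain ⟨hm, rfl, i, j, hi, -, hi', -, -, rfl, -⟩ := h
  have h2 : cheb (2 * Real.cos (Real.pi / m)) 2 = 2 * Real.cos (Real.pi / m) := by simp [cheb]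
  rcases Nat.lt_or_ge i 2 with h | h
  · left; obtain rfl : i = 1 := by omega
    simp [cheb]
  rcases Nat.lt_or_ge (i + 1) m with h' | h'
  · right
    exact h2.symm.le.trans (cheb_le_cheb hm h (by omega))
  · left; obtain rfl : i = m - 1 := by omega
    rw [cheb_sub hm (by omega)]; simp [cheb]

lemma CoefPair.eq_of_lt_two (h : CoefPair m κ c c') (hκ : 3 ≤ κ ^ 2) (hc : c < 2) (hc1 : c ≠ 1) :
    c = κ ∧ (c' = 1 ∨ c' = κ ^ 2 - 1) := by
  obtain ⟨hm, hκm, i, j, hi, hj, hi', hj', hij, rfl, rfl⟩ := h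
  have h1 : cheb κ 1 = 1 := by simp [cheb]
  have h2 : cheb κ 2 = κ := by simp [cheb]
  have h3 : cheb κ 3 = κ ^ 2 - 1 := by simp [cheb]; ring
  have hsub : ∀ {l : ℕ}, l ≤ m → cheb κ (m - l) = cheb κ l := fun hl => by
    rw [hκm]; exact cheb_sub hm hl
  have hi1 : i ≠ 1 := by rintro rfl; exact hc1 h1
  have him1 : i ≠ m - 1 := by rintro rfl; exact hc1 ((hsub (by omega)).trans h1)
  have hcase : i = 2 ∨ i = m - 2 := by
    by_contra! hcon
    have := cheb_le_cheb hm (show 3 ≤ i by omega) (by omega)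
    rw [← hκm, h3] at this
    linarith
  rcases hcase with rfl | rfl
  · refine ⟨h2, ?_⟩
    rcases hij with hij | rfl
    · obtain rfl : j = 1 := by omega
      exact .inl h1
    · exact .inr h3
  · refine ⟨(hsub (by omega)).trans h2, ?_⟩
    rcases hij with hij | rfl
    · obtain rfl : j = m - 3 := by omega
      exact .inr ((hsub (by omega)).trans h3)
    · left
      rw [show m - 2 + 1 = m - 1 by omega]
      exact (hsub (by omega)).trans h1

/-- Possible values of `2 cos (π / n)`. -/
lemma two_cos_pi_div_cases {n : ℕ} (hn : 2 ≤ n) :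
    2 * Real.cos (Real.pi / n) = 0 ∨ 2 * Real.cos (Real.pi / n) = 1 ∨
      (2 ≤ (2 * Real.cos (Real.pi / n)) ^ 2 ∧ 0 < 2 * Real.cos (Real.pi / n)) := by
  rcases Nat.lt_or_ge n 4 with h | h
  · interval_cases n
    · left; simp
    · right; left; norm_num
  · right; right
    have hn' : (4 : ℝ) ≤ n := by exact_mod_cast h
    have h1 : Real.cos (Real.pi / 4) ≤ Real.cos (Real.pi / n) := by
      apply Real.cos_le_cos_of_nonneg_of_le_pi (by positivity) (by linarith [Real.pi_pos])
      exact div_le_div_of_nonneg_left Real.pi_pos.le (by norm_num) hn'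
    rw [Real.cos_pi_div_four] at h1
    have h2 : (Real.sqrt 2) ^ 2 = 2 := Real.sq_sqrt (by norm_num)
    have h3 : 0 < Real.sqrt 2 := by positivity
    constructor <;> nlinarith

lemma two_cos_pi_div_lt_two {n : ℕ} (hn : 2 ≤ n) : 2 * Real.cos (Real.pi / n) < 2 := by
  have hn' : (2 : ℝ) ≤ n := by exact_mod_cast hn
  have h : Real.cos (Real.pi / n) < Real.cos 0 := by
    apply Real.cos_lt_cos_of_nonneg_of_le_pi le_rfl
    · rw [div_le_iff₀ (by linarith)]; nlinarith [Real.pi_pos]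
    · positivity
  rw [Real.cos_zero] at h
  linarith

lemma CoefPair.bounds (h : CoefPair m κ c c') : κ = 1 ∨ (2 ≤ κ ^ 2 ∧ 0 < κ) := by
  obtain ⟨hm, rfl, -⟩ := h
  rcases two_cos_pi_div_cases (n := m) (by omega) with h | h | h
  · exfalso
    have hm' : (3 : ℝ) ≤ m := by exact_mod_cast hm
    have : 0 < Real.cos (Real.pi / m) := by
      apply Real.cos_pos_of_mem_Ioo
      constructor
      · have : 0 < Real.pi / m := by positivity
        linarith [Real.pi_pos]
      · exact div_lt_div_of_pos_left Real.pi_pos (by norm_num) (by linarith)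
    linarith
  · exact .inl h
  · exact .inr h

lemma CoefPair.sq_eq_three (h : CoefPair m κ c c') (h3 : 3 ≤ κ ^ 2) (hlt : κ ^ 3 - 2 * κ < 2) :
    κ ^ 2 = 3 := by
  have hb := h.bounds
  have hpos : 0 < κ := by rcases hb with h | h <;> [linarith; exact h.2]
  obtain ⟨hm, hκ, -⟩ := h
  by_contra hne
  have h6 : 6 < m := by
    by_contra! hle
    apply hne
    refine le_antisymm ?_ h3
    have hm' : (3 : ℝ) ≤ m := by exact_mod_cast hm
    have hle' : (m : ℝ) ≤ 6 := by exact_mod_cast hle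
    have h1 : Real.cos (Real.pi / m) ≤ Real.cos (Real.pi / 6) := by
      apply Real.cos_le_cos_of_nonneg_of_le_pi (by positivity)
      · rw [div_le_iff₀ (by linarith)]; nlinarith [Real.pi_pos]
      · exact div_le_div_of_nonneg_left Real.pi_pos.le (by linarith) hle'
    rw [Real.cos_pi_div_six] at h1
    have h2 : (Real.sqrt 3) ^ 2 = 3 := Real.sq_sqrt (by norm_num)
    have h4 : κ ≤ Real.sqrt 3 := by linarith
    nlinarith [Real.sqrt_nonneg 3]
  have h7 : (7 : ℝ) ≤ m := by exact_mod_cast h6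
  have h1 := Real.one_sub_sq_div_two_le_cos (x := Real.pi / m)
  have h2 : Real.pi / m ≤ 3.15 / 7 := by
    have := Real.pi_lt_d2
    gcongr
  have h4 : 0 ≤ Real.pi / m := by positivity
  have h5 : (1.797 : ℝ) ≤ κ := by nlinarith
  nlinarith [mul_nonneg (sub_nonneg.2 h5) (sub_nonneg.2 h5)]

end Coefficients

end CoxeterSmall

namespace CoxeterSmall

namespace RootSys

variable {V : Type*} [AddCommGroup V] [Module ℝ V] {R : RootSys V}

/-- Two positive roots form the canonical basis of the rank two subsystem they span. -/
structure PlaneBasis (R : RootSys V) (a a' : V) : Prop where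
  left : a ∈ R.Φ
  right : a' ∈ R.Φ
  left_pos : 0 < R.ht a
  right_pos : 0 < R.ht a'
  sign : ∀ u v : ℝ, u • a + v • a' ∈ R.Φ → (0 ≤ u ∧ 0 ≤ v) ∨ (u ≤ 0 ∧ v ≤ 0)

/-- A positive root dominating no other positive root. -/
def Small (R : RootSys V) (b : V) : Prop :=
  b ∈ R.Φ ∧ ∀ γ ∈ R.Φ, 0 < R.ht γ → R.Dom γ b → γ = b

namespace PlaneBasis

variable {a a' b : V} {c c' : ℝ}

lemma symm (h : PlaneBasis R a a') : PlaneBasis R a' a :=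
  ⟨h.right, h.left, h.right_pos, h.left_pos, fun u v huv => by
    rw [add_comm] at huv
    rcases h.sign v u huv with h' | h'
    · exact .inl h'.symm
    · exact .inr h'.symm⟩

lemma form_nonpos (h : PlaneBasis R a a') : R.B a a' ≤ 0 := by
  have h1 := refl_mem h.left h.right
  rw [refl_apply, show a' - (2 * R.B a a') • a = (-(2 * R.B a a')) • a + (1 : ℝ) • a' by
    module] at h1
  rcases h.sign _ _ h1 with h' | h'
  · linarith [h'.1]
  · linarith [h'.2]

lemma form_left_nonpos_of_le_neg_one (h : PlaneBasis R a a') (hb : R.Small b)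
    (hc' : 0 < c') (hbc : b = c • a + c' • a') (hle : R.B a a' ≤ -1) :
    R.B a b ≤ 0 := by
  by_contra! hpos
  have hn := R.norm b hb.1
  have hab : R.B a b = c + c' * R.B a a' := by
    rw [hbc]; simp [R.norm a h.left]
  have hn' : c ^ 2 + c' ^ 2 + 2 * c * c' * R.B a a' = 1 := by
    rw [hbc] at hn
    simp only [map_add, map_smul, LinearMap.add_apply, LinearMap.smul_apply, smul_eq_mul,
      R.norm a h.left, R.norm a' h.right, R.symm a' a] at hn
    linarith
  have h1 : 1 ≤ R.B a b := by
    have : (R.B a b) ^ 2 = 1 + c' ^ 2 * ((R.B a a') ^ 2 - 1) := by rw [hab]; linarith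
    have h2 : 0 ≤ c' ^ 2 * ((R.B a a') ^ 2 - 1) := mul_nonneg (sq_nonneg _) (by nlinarith)
    nlinarith
  rcases dom_or_dom h.left hb.1 h1 with hd | hd
  · have heq := hb.2 a h.left h.left_pos hd
    have h2 : R.ht a = c * R.ht a + c' * R.ht a' := by
      conv_lhs => rw [heq, hbc]
      simp
    rw [← heq, R.norm a h.left] at hab
    have h3 : 1 ≤ c := by nlinarith
    nlinarith [mul_pos hc' h.right_pos, h.left_pos]
  · obtain ⟨g, hg, hgr, hneg⟩ := exists_refl_neg h.left h.left_pos
    have h2 := hd g hg hneg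
    have h3 := refl_mem h.left hb.1
    rw [hgr, refl_apply, hab] at h2
    rw [refl_apply, hab] at h3
    have e : b - (2 * (c + c' * R.B a a')) • a =
        (c - 2 * (c + c' * R.B a a')) • a + c' • a' := by rw [hbc]; module
    rw [e] at h2 h3
    simp only [map_add, map_smul, smul_eq_mul] at h2
    rcases h.sign _ _ h3 with h' | h'
    · nlinarith [mul_nonneg h'.1 h.left_pos.le, mul_pos hc' h.right_pos]
    · linarith [h'.2]

lemma neg_one_lt_form (h : PlaneBasis R a a') (hb : R.Small b)
    (hc : 0 < c) (hc' : 0 < c') (hbc : b = c • a + c' • a') : -1 < R.B a a' := by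
  by_contra! hle
  have h1 := h.form_left_nonpos_of_le_neg_one hb hc' hbc hle
  have h2 := h.symm.form_left_nonpos_of_le_neg_one hb hc (by rw [hbc, add_comm])
    (by rw [R.symm]; exact hle)
  have hn := R.norm b hb.1
  have h3 : R.B b b = c * R.B a b + c' * R.B a' b := by
    rw [R.symm a b, R.symm a' b]
    simpa using congrArg (R.B b) hbc
  nlinarith

/-- A small root which is not simple in a rank two subsystem forces the latter to be finite. -/
lemma exists_coefPair (h : PlaneBasis R a a') (hb : R.Small b)
    (hc : 0 < c) (hc' : 0 < c') (hbc : b = c • a + c' • a') :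
    ∃ m κ, CoefPair m κ c c' ∧ R.B a a' = -(κ / 2) := by
  have hlow := h.neg_one_lt_form hb hc hc' hbc
  have hnp := h.form_nonpos
  set θ := Real.arccos (-R.B a a') with hθ
  have hcos : Real.cos θ = -R.B a a' := Real.cos_arccos (by linarith) (by linarith)
  have hθ0 : 0 < θ := Real.arccos_pos.2 (by linarith)
  have hθpi : θ < Real.pi := by
    have : θ ≤ Real.pi / 2 := Real.arccos_le_pi_div_two.2 (by linarith)
    linarith [Real.pi_pos]
  have hsin : 0 < Real.sin θ := Real.sin_pos_of_pos_of_lt_pi hθ0 hθpi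
  obtain ⟨n, hn, ha', hna⟩ := exists_orthonorm R.symm (R.norm a h.left) (R.norm a' h.right)
    hsin.ne' (show R.B a a' = -Real.cos θ by linarith)
  have hΦ : ∀ x ∈ R.Φ, ∀ y ∈ R.Φ, refl R.B x y ∈ R.Φ := fun x hx y hy => refl_mem hx hy
  have hcoord : ∀ φ, circ a n φ = (Real.sin (φ + θ) / Real.sin θ) • a +
      (Real.sin φ / Real.sin θ) • a' := fun φ => by
    rw [circ, hna, Real.sin_add, smul_smul, smul_add, smul_smul]
    match_scalars <;> field_simp <;> ring
  have hθΦ : circ a n θ ∈ R.Φ := by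
    have h1 := refl_mem h.left h.right
    have h2 := hn.refl_circ 0 (Real.pi - θ)
    rw [circ_zero, ← ha'] at h2
    rw [h2] at h1
    convert h1 using 2; ring
  have hgap : ∀ φ, circ a n φ ∈ R.Φ → 0 < φ → θ ≤ φ := by
    intro φ hφ hφ0
    by_contra! hlt
    have h1 := refl_mem h.left hφ
    have h2 := hn.refl_circ 0 φ
    rw [circ_zero, show 2 * 0 - φ + Real.pi = Real.pi - φ by ring] at h2
    rw [h2, hcoord] at h1
    have p1 : 0 < Real.sin (Real.pi - φ) / Real.sin θ := by
      rw [Real.sin_pi_sub]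
      exact div_pos (Real.sin_pos_of_pos_of_lt_pi hφ0 (by linarith)) hsin
    have p2 : Real.sin (Real.pi - φ + θ) / Real.sin θ < 0 := by
      rw [show Real.pi - φ + θ = Real.pi - (φ - θ) by ring, Real.sin_pi_sub]
      exact div_neg_of_neg_of_pos
        (Real.sin_neg_of_neg_of_neg_pi_lt (by linarith) (by linarith)) hsin
    rcases h.sign _ _ h1 with h' | h' <;> linarith [h'.1, h'.2]
  obtain ⟨hmul, m, hm⟩ := hn.exists_int_mul_of_gap hΦ h.left hθΦ hθ0 hgap
  have hbn : c ^ 2 + c' ^ 2 - 2 * c * c' * Real.cos θ = 1 := by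
    have hbb := R.norm b hb.1
    rw [hbc] at hbb
    simp only [map_add, map_smul, LinearMap.add_apply, LinearMap.smul_apply, smul_eq_mul,
      R.norm a h.left, R.norm a' h.right, R.symm a' a] at hbb
    rw [hcos]; linarith
  set x := c - c' * Real.cos θ with hx
  have hxy : x ^ 2 + (c' * Real.sin θ) ^ 2 = 1 := by
    nlinarith [Real.sin_sq_add_cos_sq θ]
  have hy : 0 < c' * Real.sin θ := mul_pos hc' hsin
  have hx1 : -1 < x := by nlinarith
  have hx2 : x < 1 := by nlinarith
  set φ := Real.arccos x with hφ
  have hcφ : Real.cos φ = x := Real.cos_arccos hx1.le hx2.le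
  have hsφ : Real.sin φ = c' * Real.sin θ := by
    rw [hφ, Real.sin_arccos, show 1 - x ^ 2 = (c' * Real.sin θ) ^ 2 by linarith,
      Real.sqrt_sq hy.le]
  have hφ0 : 0 < φ := Real.arccos_pos.2 hx2
  have hφpi : φ < Real.pi := by
    refine lt_of_le_of_ne (Real.arccos_le_pi x) fun heq => ?_
    rw [heq, Real.sin_pi] at hsφ
    linarith
  have hsum : Real.sin (φ + θ) = c * Real.sin θ := by
    rw [Real.sin_add, hcφ, hsφ, hx]; ring
  have hbφ : circ a n φ = b := by
    rw [hcoord, hsum, hsφ, hbc, mul_div_cancel_right₀ _ hsin.ne', mul_div_cancel_right₀ _ hsin.ne']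
  obtain ⟨z, hz⟩ := hmul φ (by rw [hbφ]; exact hb.1)
  have hz0 : 0 < (z : ℝ) := by
    by_contra! hcon
    nlinarith
  have hz1 : 0 ≤ z := by exact_mod_cast hz0.le
  lift z to ℕ using hz1
  have hzc : φ = (z : ℝ) * θ := by exact_mod_cast hz
  have hz0' : 1 ≤ z := by
    have : (0 : ℝ) < (z : ℝ) := by exact_mod_cast hz0
    exact_mod_cast this
  have hzm : z + 1 < m := by
    have h1 : φ + θ < Real.pi := by
      by_contra! hcon
      have : Real.sin (φ + θ) ≤ 0 := by
        rw [show φ + θ = (φ + θ - Real.pi) + Real.pi by ring, Real.sin_add_pi]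
        have := Real.sin_nonneg_of_nonneg_of_le_pi (x := φ + θ - Real.pi) (by linarith)
          (by linarith)
        linarith
      nlinarith [mul_pos hc hsin]
    rw [hzc, hm] at h1
    have : ((z : ℝ) + 1) < m := by nlinarith
    exact_mod_cast this
  have hm0 : (0 : ℝ) < m := by
    have : 0 < m := by omega
    exact_mod_cast this
  have hθm : θ = Real.pi / m := by rw [hm]; field_simp
  refine ⟨m, 2 * Real.cos θ, ⟨by omega, by rw [← hθm], z + 1, z, by omega, hz0', hzm, by omega,
    .inl rfl, ?_, ?_⟩, by linarith⟩
  · apply mul_left_cancel₀ hsin.ne'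
    rw [sin_mul_cheb]
    push_cast
    rw [add_mul, ← hzc, one_mul, hsum, mul_comm]
  · apply mul_left_cancel₀ hsin.ne'
    rw [sin_mul_cheb, ← hzc, hsφ, mul_comm]

end PlaneBasis

end RootSys

end CoxeterSmall

namespace CoxeterSmall

namespace RootSys

variable {V : Type*} [AddCommGroup V] [Module ℝ V] {R : RootSys V}

/-- A functional which is a sum of translates of the height. -/
def IsHeightSum (R : RootSys V) (p : V →ₗ[ℝ] ℝ) : Prop :=
  ∃ (m : ℕ) (g : ℕ → V ≃ₗ[ℝ] V), 0 < m ∧ (∀ i, g i ∈ R.G) ∧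
    ∀ v, p v = ∑ i ∈ Finset.range m, R.ht (g i v)

lemma IsHeightSum.finite {p : V →ₗ[ℝ] ℝ} (hp : R.IsHeightSum p) :
    {β | β ∈ R.Φ ∧ 0 < R.ht β ∧ p β < 0}.Finite := by
  obtain ⟨m, g, -, hg, hpg⟩ := hp
  refine (Set.Finite.biUnion (Finset.finite_toSet (Finset.range m))
    (fun i _ => R.finite_inv (g i) (hg i))).subset ?_
  rintro β ⟨hβ, hpos, hneg⟩
  rw [hpg] at hneg
  obtain ⟨i, hi, hlt⟩ : ∃ i ∈ Finset.range m, R.ht (g i β) < 0 := by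
    by_contra! hcon
    exact absurd (Finset.sum_nonneg hcon) (not_le.2 hneg)
  exact Set.mem_biUnion hi ⟨hβ, hpos, hlt⟩

lemma Dom.heightSum_lt {p : V →ₗ[ℝ] ℝ} (hp : R.IsHeightSum p) {α β : V} (hα : α ∈ R.Φ)
    (hβ : β ∈ R.Φ) (h : R.Dom α β) (hne : α ≠ β) : ∃ l : ℝ, 0 < l ∧ p α < l * p β := by
  obtain ⟨m, g, hm, hg, hpg⟩ := hp
  have hx := h.one_le_form hα hβ
  set x := R.B α β with hxdef
  set l := x + Real.sqrt (x ^ 2 - 1) with hl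
  have hs : Real.sqrt (x ^ 2 - 1) ^ 2 = x ^ 2 - 1 := Real.sq_sqrt (by nlinarith)
  have hl0 : 0 < l := by
    have := Real.sqrt_nonneg (x ^ 2 - 1)
    linarith
  have hlinv : l⁻¹ = x - Real.sqrt (x ^ 2 - 1) := by
    refine inv_eq_of_mul_eq_one_right ?_
    rw [hl]; nlinarith
  refine ⟨l, hl0, ?_⟩
  rw [hpg, hpg, Finset.mul_sum]
  refine Finset.sum_lt_sum_of_nonempty (Finset.nonempty_range_iff.2 hm.ne') fun i _ => ?_
  exact h.ht_map_lt hα hβ hne hl0 (by rw [hlinv, ← hxdef]; ring) (hg i)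

lemma sum_circ_eq_zero (a n : V) {m : ℕ} (hm : 2 ≤ m) (φ : ℝ) :
    ∑ i ∈ Finset.range m, circ a n (φ + i * (2 * (Real.pi / m))) = 0 := by
  have hm' : (2 : ℝ) ≤ m := by exact_mod_cast hm
  set θ := Real.pi / m with hθ
  have hmθ : m * θ = Real.pi := by rw [hθ]; field_simp
  have hs : 0 < Real.sin θ := by
    apply Real.sin_pos_of_pos_of_lt_pi (by positivity)
    nlinarith [Real.pi_pos]
  let f : ℕ → V := fun i => circ a n (φ + i * (2 * θ) - θ - Real.pi / 2)
  have hstep : ∀ i : ℕ, (2 * Real.sin θ) • circ a n (φ + i * (2 * θ)) = f (i + 1) - f i := by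
    intro i
    simp only [f]
    have e : φ + ((i + 1 : ℕ) : ℝ) * (2 * θ) - θ - Real.pi / 2 =
        (φ + i * (2 * θ)) + θ - Real.pi / 2 := by push_cast; ring
    rw [e]
    simp only [circ, Real.cos_sub_pi_div_two, Real.sin_sub_pi_div_two, Real.sin_add,
      Real.cos_add _ θ, Real.sin_sub _ θ, Real.cos_sub _ θ]
    module
  have hsum : (2 * Real.sin θ) • ∑ i ∈ Finset.range m, circ a n (φ + i * (2 * θ)) = 0 := by
    rw [Finset.smul_sum, Finset.sum_congr rfl fun i _ => hstep i, Finset.sum_range_sub]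
    simp only [f]
    rw [show φ + (m : ℝ) * (2 * θ) - θ - Real.pi / 2 =
      (φ + ((0 : ℕ) : ℝ) * (2 * θ) - θ - Real.pi / 2) + 2 * Real.pi by
        rw [← hmθ]; push_cast; ring, circ_add_two_pi, sub_self]
  exact (smul_eq_zero.1 hsum).resolve_left (by positivity)

/-- Averaging the height over the rotations of a finite rank two subsystem gives a functional
vanishing on its plane. -/
lemma exists_heightSum {a a' : V} (ha : a ∈ R.Φ) (ha' : a' ∈ R.Φ) {m : ℕ} (hm : 2 ≤ m)
    (hB : R.B a a' = -Real.cos (Real.pi / m)) :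
    ∃ p : V →ₗ[ℝ] ℝ, R.IsHeightSum p ∧ p a = 0 ∧ p a' = 0 := by
  have hm' : (2 : ℝ) ≤ m := by exact_mod_cast hm
  have hs : 0 < Real.sin (Real.pi / m) := by
    apply Real.sin_pos_of_pos_of_lt_pi (by positivity)
    rw [div_lt_iff₀ (by linarith)]; nlinarith [Real.pi_pos]
  obtain ⟨n, hn, ha'n, -⟩ := exists_orthonorm R.symm (R.norm a ha) (R.norm a' ha') hs.ne' hB
  obtain ⟨g, hg, hgr⟩ := R.exists_refl a ha
  obtain ⟨g', hg', hgr'⟩ := R.exists_refl a' ha'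
  have hpow : ∀ (i : ℕ) (v : V), ((g * g') ^ i) v = ((refl R.B a * refl R.B a') ^ i) v := by
    intro i
    induction i with
    | zero => intro v; rfl
    | succ i ih =>
      intro v
      rw [pow_succ', pow_succ', LinearEquiv.mul_apply, ih, LinearEquiv.mul_apply, hgr, hgr']
      rfl
  let p : V →ₗ[ℝ] ℝ := ∑ i ∈ Finset.range m, R.ht ∘ₗ ((g * g') ^ i).toLinearMap
  have hpv : ∀ v, p v = ∑ i ∈ Finset.range m, R.ht (((g * g') ^ i) v) := fun v => by
    simp [p]
  have hcirc : ∀ φ, p (circ a n φ) = 0 := fun φ => by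
    rw [hpv, ← map_sum]
    simp only [hpow]
    rw [ha'n]
    simp only [refl_comp_iterate_circ hn]
    rw [sum_circ_eq_zero a n hm, map_zero]
  refine ⟨p, ⟨m, fun i => (g * g') ^ i, by omega, fun i => R.G.pow_mem (R.G.mul_mem hg hg') i,
    hpv⟩, ?_, ?_⟩
  · rw [← circ_zero a n]; exact hcirc 0
  · rw [ha'n]; exact hcirc _

/-- Roots on the negative side of a height sum killing a small root `b` pair with `b` to less
than `1`. -/
lemma Small.form_lt_one {b : V} (hb : R.Small b) {p : V →ₗ[ℝ] ℝ} (hp : R.IsHeightSum p)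
    (hpb : p b = 0) {δ : V} (hδ : δ ∈ R.Φ) (hpos : 0 < R.ht δ) (hneg : p δ < 0) :
    R.B b δ < 1 := by
  by_contra! hcon
  rcases dom_or_dom hb.1 hδ hcon with h | h
  · have hne : b ≠ δ := by rintro rfl; linarith
    obtain ⟨l, hl, hlt⟩ := h.heightSum_lt hp hb.1 hδ hne
    nlinarith [mul_pos hl (neg_pos.2 hneg)]
  · have := hb.2 δ hδ hpos h
    subst this
    linarith

section Choice

variable {p : V →ₗ[ℝ] ℝ} {a a' ε γ : V}

/-- The positive roots on the negative side of `p` which together with `a` and `a'` generate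
`γ`. -/
def Witness (R : RootSys V) (p : V →ₗ[ℝ] ℝ) (a a' γ ε : V) : Prop :=
  ε ∈ R.Φ ∧ 0 < R.ht ε ∧ p ε < 0 ∧ ReflClosure R.B {a, a', ε} γ

lemma Witness.symm (h : R.Witness p a a' γ ε) : R.Witness p a' a γ ε := by
  obtain ⟨h1, h2, h3, h4⟩ := h
  exact ⟨h1, h2, h3, by rwa [Set.insert_comm]⟩

/-- Lexicographic maximality for `(p, ht)` among witnesses. -/
def MaxWitness (R : RootSys V) (p : V →ₗ[ℝ] ℝ) (a a' γ ε : V) : Prop :=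
  R.Witness p a a' γ ε ∧ ∀ δ, R.Witness p a a' γ δ →
    p δ ≤ p ε ∧ (p δ = p ε → R.ht δ ≤ R.ht ε)

lemma MaxWitness.symm (h : R.MaxWitness p a a' γ ε) : R.MaxWitness p a' a γ ε :=
  ⟨h.1.symm, fun δ hδ => h.2 δ hδ.symm⟩

lemma exists_maxWitness (hp : R.IsHeightSum p) (hγ : γ ∈ R.Φ) (hpos : 0 < R.ht γ)
    (hneg : p γ < 0) : ∃ ε, R.MaxWitness p a a' γ ε := by
  have hfin : {ε | R.Witness p a a' γ ε}.Finite :=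
    hp.finite.subset fun ε hε => ⟨hε.1, hε.2.1, hε.2.2.1⟩
  have hne : {ε | R.Witness p a a' γ ε}.Nonempty :=
    ⟨γ, hγ, hpos, hneg, .base (by simp)⟩
  obtain ⟨ε, hε, hmax⟩ := Set.exists_max_image _ (fun ε => toLex (p ε, R.ht ε)) hfin hne
  refine ⟨ε, hε, fun δ hδ => ?_⟩
  have := hmax δ hδ
  rw [Prod.Lex.le_iff] at this
  simp only [ofLex_toLex] at this
  rcases this with h | h
  · exact ⟨h.le, fun h' => absurd h' h.ne⟩
  · exact ⟨h.1.le, fun _ => h.2⟩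

lemma MaxWitness.form_nonneg (h : R.MaxWitness p a a' γ ε) (ha : a ∈ R.Φ) (hapos : 0 < R.ht a)
    (hpa : p a = 0) : 0 ≤ R.B a ε := by
  by_contra! hneg
  obtain ⟨⟨h1, h2, h3, h4⟩, hmax⟩ := h
  have hht : R.ht (refl R.B a ε) = R.ht ε - 2 * R.B a ε * R.ht a := by
    rw [refl_apply]; simp
  have hpp : p (refl R.B a ε) = p ε := by rw [refl_apply]; simp [hpa]
  have hlt : R.ht ε < R.ht (refl R.B a ε) := by
    rw [hht]; nlinarith
  have hw : R.Witness p a a' γ (refl R.B a ε) := by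
    refine ⟨refl_mem ha h1, h2.trans hlt, by rwa [hpp], h4.trans ?_⟩
    rintro x (rfl | rfl | rfl)
    · exact .base (by simp)
    · exact .base (by simp)
    · have key : ReflClosure R.B {a, a', refl R.B a x} (refl R.B a (refl R.B a x)) :=
        .refl (.base (by simp)) (.base (by simp))
      rwa [refl_refl (R.norm a ha)] at key
  exact absurd ((hmax _ hw).2 hpp) (not_le.2 hlt)

/-- A maximal witness meets `a` at an angle `π / n`. -/
lemma MaxWitness.exists_form_eq_cos (h : R.MaxWitness p a a' γ ε) (hp : R.IsHeightSum p)
    (ha : a ∈ R.Φ) (hapos : 0 < R.ht a) (hpa : p a = 0) (hx1 : R.B a ε < 1) :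
    ∃ n : ℕ, 2 ≤ n ∧ R.B a ε = Real.cos (Real.pi / n) := by
  have hx0 := h.form_nonneg ha hapos hpa
  obtain ⟨⟨h1, h2, h3, h4⟩, hmax⟩ := h
  set θ := Real.arccos (R.B a ε) with hθ
  have hcos : Real.cos θ = R.B a ε := Real.cos_arccos (by linarith) (by linarith)
  have hθ0 : 0 < θ := Real.arccos_pos.2 hx1
  have hθ2 : θ ≤ Real.pi / 2 := Real.arccos_le_pi_div_two.2 hx0
  have hpi := Real.pi_pos
  have hsin : 0 < Real.sin θ := Real.sin_pos_of_pos_of_lt_pi hθ0 (by linarith)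
  obtain ⟨n, hn, hεn, hnε⟩ := exists_orthonorm R.symm (R.norm a ha) (R.norm ε h1)
    (θ := Real.pi - θ) (by rw [Real.sin_pi_sub]; exact hsin.ne')
    (by rw [Real.cos_pi_sub, hcos, neg_neg])
  rw [sub_sub_cancel] at hεn
  rw [Real.sin_pi_sub, Real.cos_pi_sub] at hnε
  have hcoord : ∀ φ, circ a n φ = (Real.sin (θ - φ) / Real.sin θ) • a +
      (Real.sin φ / Real.sin θ) • ε := fun φ => by
    rw [circ, hnε, Real.sin_sub, smul_smul, smul_add, smul_smul]
    match_scalars <;> field_simp; ring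
  have hpcirc : ∀ φ, p (circ a n φ) = Real.sin φ / Real.sin θ * p ε := fun φ => by
    rw [hcoord]; simp [hpa]
  let Ψ : Set V := {v | ReflClosure R.B {a, ε} v}
  have hΨ : ∀ x ∈ Ψ, ∀ y ∈ Ψ, refl R.B x y ∈ Ψ := fun x hx y hy => .refl hx hy
  have haΨ : a ∈ Ψ := .base (by simp)
  have hΨΦ : Ψ ⊆ R.Φ := fun v hv => closure_mem (by
    rintro x (rfl | rfl)
    · exact ha
    · exact h1) hv
  have hneg : ∀ φ, 0 < φ → φ ≤ θ → circ a n φ ∈ Ψ →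
      circ a n φ ∈ {β | β ∈ R.Φ ∧ 0 < R.ht β ∧ p β < 0} := by
    intro φ hφ0 hφθ hφ
    have q1 : 0 ≤ Real.sin (θ - φ) / Real.sin θ :=
      div_nonneg (Real.sin_nonneg_of_nonneg_of_le_pi (by linarith) (by linarith)) hsin.le
    have q2 : 0 < Real.sin φ / Real.sin θ :=
      div_pos (Real.sin_pos_of_pos_of_lt_pi hφ0 (by linarith)) hsin
    refine ⟨hΨΦ hφ, ?_, ?_⟩
    · rw [hcoord]
      simp only [map_add, map_smul, smul_eq_mul]
      exact add_pos_of_nonneg_of_pos (mul_nonneg q1 hapos.le) (mul_pos q2 h2)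
    · rw [hpcirc]; exact mul_neg_of_pos_of_neg q2 h3
  let A : Set ℝ := {φ | 0 < φ ∧ φ ≤ θ ∧ circ a n φ ∈ Ψ}
  have hAfin : A.Finite := by
    refine Set.Finite.of_finite_image (f := circ a n)
      (hp.finite.subset ?_) ?_
    · rintro _ ⟨φ, ⟨hφ0, hφθ, hφ⟩, rfl⟩
      exact hneg φ hφ0 hφθ hφ
    · intro φ hφ χ hχ heq
      have h5 := congrArg p heq
      rw [hpcirc, hpcirc] at h5
      have h6 : Real.sin φ = Real.sin χ := by
        have := mul_right_cancel₀ h3.ne h5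
        field_simp at this
        exact this
      exact Real.injOn_sin ⟨by linarith [hφ.1], hφ.2.1.trans hθ2⟩
        ⟨by linarith [hχ.1], hχ.2.1.trans hθ2⟩ h6
  obtain ⟨ψ, ⟨hψ0, hψθ, hψ⟩, hmin⟩ := Set.exists_min_image A id hAfin
    ⟨θ, hθ0, le_rfl, .base (by simp [← hεn])⟩
  obtain ⟨hmul, N, hN⟩ := hn.exists_int_mul_of_gap hΨ haΨ hψ hψ0 (fun φ hφ hφ0 => by
    rcases le_or_gt φ θ with h' | h'
    · exact hmin φ ⟨hφ0, h', hφ⟩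
    · linarith)
  obtain ⟨z, hz⟩ := hmul θ (.base (by simp [← hεn]))
  have hz0 : 0 ≤ z := by
    have : 0 ≤ (z : ℝ) := by
      by_contra! hcon
      nlinarith
    exact_mod_cast this
  lift z to ℕ using hz0
  have hz' : θ = (z : ℝ) * ψ := by exact_mod_cast hz
  have hεmem : ReflClosure R.B {a, circ a n ψ} ε := by
    have := (hn.circ_nat_mul_mem (Ψ := {v | ReflClosure R.B {a, circ a n ψ} v})
      (fun x hx y hy => .refl hx hy) (.base (by simp)) (.base (by simp)) (ψ := ψ) z).1
    rw [← hz', ← hεn] at this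
    exact this
  obtain ⟨w1, w2, w3⟩ := hneg ψ hψ0 hψθ hψ
  have hw : R.Witness p a a' γ (circ a n ψ) := by
    refine ⟨w1, w2, w3, h4.trans ?_⟩
    rintro x (rfl | rfl | rfl)
    · exact .base (by simp)
    · exact .base (by simp)
    · refine hεmem.trans ?_
      rintro y (rfl | rfl) <;> exact .base (by simp)
  have hle := (hmax _ hw).1
  rw [hpcirc] at hle
  have hψeq : ψ = θ := by
    refine le_antisymm hψθ ?_
    by_contra! hlt
    have h5 : Real.sin ψ < Real.sin θ :=
      Real.sin_lt_sin_of_lt_of_le_pi_div_two (by linarith) hθ2 hlt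
    have h6 : Real.sin ψ / Real.sin θ < 1 := (div_lt_one hsin).2 h5
    nlinarith
  rw [hψeq] at hN
  have hN2 : 2 ≤ N := by
    have : (2 : ℝ) ≤ N := by
      by_contra! hcon
      nlinarith
    exact_mod_cast this
  have hN0 : (0 : ℝ) < N := by
    have : 0 < N := by omega
    exact_mod_cast this
  refine ⟨N, hN2, ?_⟩
  rw [← hcos, hN]
  congr 1
  field_simp

end Choice

end RootSys

end CoxeterSmall

namespace CoxeterSmall

lemma ReflClosure.neg {V : Type*} [AddCommGroup V] [Module ℝ V] {B : LinearMap.BilinForm ℝ V}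
    {X : Set V} {v : V} (hv : ReflClosure B X v) (h1 : B v v = 1) : ReflClosure B X (-v) := by
  rw [← refl_self h1]
  exact .refl hv hv

lemma ReflClosure.exists_coords {V : Type*} [AddCommGroup V] [Module ℝ V]
    {B : LinearMap.BilinForm ℝ V} {x y z v : V} (hv : ReflClosure B {x, y, z} v) :
    ∃ i j k : ℝ, v = i • x + j • y + k • z := by
  induction hv with
  | base h =>
    rcases h with rfl | rfl | rfl
    · exact ⟨1, 0, 0, by module⟩
    · exact ⟨0, 1, 0, by module⟩
    · exact ⟨0, 0, 1, by module⟩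
  | @refl u w _ _ hu hw =>
    obtain ⟨i, j, k, hu⟩ := hu
    obtain ⟨i', j', k', hw⟩ := hw
    refine ⟨i' - 2 * B u w * i, j' - 2 * B u w * j, k' - 2 * B u w * k, ?_⟩
    rw [refl_apply]
    generalize 2 * B u w = q
    rw [hu, hw]
    module

/-- The linear Coxeter diagram on three vertices with edge labels `m` and `n`. -/
def pathMatrix (m n : ℕ) (hm : 2 ≤ m) (hn : 2 ≤ n) : CoxeterMatrix (Fin 3) where
  M := !![1, m, 2; m, 1, n; 2, n, 1]
  isSymm := by
    ext i j
    fin_cases i <;> fin_cases j <;> rfl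
  diagonal i := by fin_cases i <;> rfl
  off_diagonal i j hij := by
    fin_cases i <;> fin_cases j <;> simp at hij ⊢ <;> omega

namespace RootSys

variable {V : Type*} [AddCommGroup V] [Module ℝ V] {R : RootSys V}

/-- Three positive roots forming a simple system of the type of a path with edges weighted by
`κ = 2 cos (π / m)` and `μ = 2 cos (π / n)`. -/
structure PathBasis (R : RootSys V) (κ μ : ℝ) (e₁ e₂ e₃ : V) : Prop where
  mem₁ : e₁ ∈ R.Φ
  mem₂ : e₂ ∈ R.Φ
  mem₃ : e₃ ∈ R.Φ
  pos₁ : 0 < R.ht e₁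
  pos₂ : 0 < R.ht e₂
  pos₃ : 0 < R.ht e₃
  form₁₂ : R.B e₁ e₂ = -(κ / 2)
  form₂₃ : R.B e₂ e₃ = -(μ / 2)
  form₁₃ : R.B e₁ e₃ = 0
  left_eq : ∃ m : ℕ, 2 ≤ m ∧ κ = 2 * Real.cos (Real.pi / m)
  right_eq : ∃ n : ℕ, 2 ≤ n ∧ μ = 2 * Real.cos (Real.pi / n)

lemma two_cos_pi_div_nonneg {n : ℕ} (hn : 2 ≤ n) : 0 ≤ 2 * Real.cos (Real.pi / n) := by
  rcases two_cos_pi_div_cases hn with h | h | h <;> linarith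

namespace PathBasis

variable {κ μ : ℝ} {e₁ e₂ e₃ a γ : V}

lemma symm (h : R.PathBasis κ μ e₁ e₂ e₃) : R.PathBasis μ κ e₃ e₂ e₁ :=
  ⟨h.mem₃, h.mem₂, h.mem₁, h.pos₃, h.pos₂, h.pos₁, by rw [R.symm, h.form₂₃],
    by rw [R.symm, h.form₁₂], by rw [R.symm, h.form₁₃], h.right_eq, h.left_eq⟩

lemma coords_eq_zero (h : R.PathBasis κ μ e₁ e₂ e₃) {i j k : ℝ}
    (h0 : i • e₁ + j • e₂ + k • e₃ = 0) : i = 0 ∧ j = 0 ∧ k = 0 := by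
  obtain ⟨m, hm, hκ⟩ := h.left_eq
  obtain ⟨n, hn, hμ⟩ := h.right_eq
  have hκ0 := two_cos_pi_div_nonneg hm
  have hμ0 := two_cos_pi_div_nonneg hn
  rw [← hκ] at hκ0
  rw [← hμ] at hμ0
  have q1 := congrArg (R.B e₁) h0
  have q3 := congrArg (R.B e₃) h0
  have qh := congrArg R.ht h0
  simp only [map_add, map_smul, smul_eq_mul, R.norm _ h.mem₁, R.norm _ h.mem₃, h.form₁₂,
    h.form₁₃, R.symm e₃ e₂, R.symm e₃ e₁, h.form₂₃, map_zero] at q1 q3 qh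
  have hi : i = κ / 2 * j := by linarith
  have hk : k = μ / 2 * j := by linarith
  have hj : j * (κ / 2 * R.ht e₁ + R.ht e₂ + μ / 2 * R.ht e₃) = 0 := by
    rw [hi, hk] at qh; linarith
  have hpos : 0 < κ / 2 * R.ht e₁ + R.ht e₂ + μ / 2 * R.ht e₃ := by
    have := h.pos₁; have := h.pos₂; have := h.pos₃
    positivity
  have hj0 := (mul_eq_zero.1 hj).resolve_right hpos.ne'
  exact ⟨by rw [hi, hj0, mul_zero], hj0, by rw [hk, hj0, mul_zero]⟩

lemma exists_sign (h : R.PathBasis κ μ e₁ e₂ e₃) (hγ : ReflClosure R.B {e₁, e₂, e₃} γ) :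
    ∃ i j k : ℝ, γ = i • e₁ + j • e₂ + k • e₃ ∧
      ((0 ≤ i ∧ 0 ≤ j ∧ 0 ≤ k) ∨ (i ≤ 0 ∧ j ≤ 0 ∧ k ≤ 0)) := by
  obtain ⟨m, hm, hκ⟩ := h.left_eq
  obtain ⟨n, hn, hμ⟩ := h.right_eq
  have hm0 : m ≠ 0 := by omega
  have hn0 : n ≠ 0 := by omega
  have hset : ({e₁, e₂, e₃} : Set V) = Set.range ![e₁, e₂, e₃] := by
    simp only [Matrix.range_cons, Matrix.range_empty, Set.union_empty]
    ext x; simp; tauto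
  rw [hset] at hγ
  obtain ⟨v, hv, hs⟩ := hγ.exists_sign (M := pathMatrix m n hm hn) (fun s t => by
    have q1 : -(κ / 2) = -Real.cos (Real.pi / m) := by rw [hκ]; ring
    have q2 : -(μ / 2) = -Real.cos (Real.pi / n) := by rw [hμ]; ring
    fin_cases s <;> fin_cases t <;>
      simp [formCoeff, pathMatrix, hm0, hn0, R.norm _ h.mem₁, R.norm _ h.mem₂, R.norm _ h.mem₃,
        h.form₁₂, h.form₁₃, h.form₂₃, R.symm e₃ e₂, R.symm e₃ e₁, R.symm e₂ e₁, q1, q2])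
  refine ⟨v 0, v 1, v 2, by rw [hv, Fin.sum_univ_three]; rfl, ?_⟩
  rcases hs with hs | hs
  · exact .inl ⟨hs 0, hs 1, hs 2⟩
  · exact .inr ⟨hs 0, hs 1, hs 2⟩

/-- In a path system, a positive root dominated by a root of the first rank two parabolic
subsystem equals it. -/
lemma eq_of_dom (h : R.PathBasis κ μ e₁ e₂ e₃) {u u' : ℝ} (hau : a = u • e₁ + u' • e₂)
    (ha : ReflClosure R.B {e₁, e₂, e₃} a) (hapos : 0 < R.ht a)
    (hγ : ReflClosure R.B {e₁, e₂, e₃} γ) (hpos : 0 < R.ht γ) (hd : R.Dom γ a) : γ = a := by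
  have hX : ({e₁, e₂, e₃} : Set V) ⊆ R.Φ := by
    rintro x (rfl | rfl | rfl)
    exacts [h.mem₁, h.mem₂, h.mem₃]
  have haΦ := closure_mem hX ha
  have hγΦ := closure_mem hX hγ
  have p1 := h.pos₁
  have p2 := h.pos₂
  have p3 := h.pos₃
  obtain ⟨i, j, k, hijk, hs⟩ := h.exists_sign hγ
  have hk0 : 0 ≤ k := by
    rcases hs with hs | ⟨s1, s2, s3⟩
    · exact hs.2.2
    · have : R.ht γ = i * R.ht e₁ + j * R.ht e₂ + k * R.ht e₃ := by rw [hijk]; simp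
      nlinarith
  obtain ⟨i', j', k', hijk', hs'⟩ := h.exists_sign (ReflClosure.refl ha hγ)
  obtain ⟨g, hg, hgr, hgneg⟩ := exists_refl_neg haΦ hapos
  have hneg : R.ht (refl R.B a γ) < 0 := by rw [← hgr]; exact hd g hg hgneg
  have hk'0 : k' ≤ 0 := by
    rcases hs' with ⟨s1, s2, s3⟩ | hs'
    · have : R.ht (refl R.B a γ) = i' * R.ht e₁ + j' * R.ht e₂ + k' * R.ht e₃ := by
        rw [hijk']; simp
      have := mul_nonneg s1 p1.le
      have := mul_nonneg s2 p2.le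
      have := mul_nonneg s3 p3.le
      linarith
    · exact hs'.2.2
  have hkk : k = k' := by
    rw [refl_apply] at hijk'
    generalize 2 * R.B a γ = q at hijk'
    rw [hau, hijk] at hijk'
    have h0 : (i - q * u - i') • e₁ + (j - q * u' - j') • e₂ + (k - k') • e₃ = 0 := by
      rw [← sub_eq_zero] at hijk'
      rw [← hijk']; module
    linarith [(h.coords_eq_zero h0).2.2]
  have hk : k = 0 := by linarith
  have hform := hd.one_le_form hγΦ haΦ
  have hdiff : γ - a = (i - u) • e₁ + (j - u') • e₂ := by
    rw [hijk, hau, hk]; module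
  have hn : R.B (γ - a) (γ - a) ≤ 0 := by
    simp only [map_sub, LinearMap.sub_apply, R.norm _ hγΦ, R.norm _ haΦ, R.symm a γ]
    linarith
  rw [hdiff] at hn
  simp only [map_add, map_smul, LinearMap.add_apply, LinearMap.smul_apply, smul_eq_mul,
    R.norm _ h.mem₁, R.norm _ h.mem₂, h.form₁₂, R.symm e₂ e₁] at hn
  obtain ⟨m, hm, hκ⟩ := h.left_eq
  have hκ0 := two_cos_pi_div_nonneg hm
  have hκ2 := two_cos_pi_div_lt_two hm
  rw [← hκ] at hκ0 hκ2
  generalize i - u = x at hn hdiff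
  generalize j - u' = y at hn hdiff
  have hsq : 0 < 1 - κ ^ 2 / 4 := by nlinarith
  have hn' : (x - κ / 2 * y) ^ 2 + (1 - κ ^ 2 / 4) * y ^ 2 ≤ 0 := by linarith
  have hy : y = 0 := by
    by_contra hy
    have := mul_pos hsq (pow_pos (abs_pos.2 hy) 2)
    rw [sq_abs] at this
    linarith [sq_nonneg (x - κ / 2 * y)]
  subst hy
  have hx : x = 0 := by nlinarith
  subst hx
  rw [← sub_eq_zero, hdiff]; module

end PathBasis

end RootSys

end CoxeterSmall

namespace CoxeterSmall

namespace RootSys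

variable {V : Type*} [AddCommGroup V] [Module ℝ V] {R : RootSys V}

/-- Two roots `h, k` killed by `p` and a root `ε` orthogonal to `h` with `p ε < 0`, all positive,
generating the positive root `γ`. -/
structure Config (R : RootSys V) (p : V →ₗ[ℝ] ℝ) (κ μ : ℝ) (h k ε γ : V) : Prop where
  h_mem : h ∈ R.Φ
  k_mem : k ∈ R.Φ
  ε_mem : ε ∈ R.Φ
  h_pos : 0 < R.ht h
  k_pos : 0 < R.ht k
  ε_pos : 0 < R.ht ε
  form_hk : R.B h k = -(κ / 2)
  form_hε : R.B h ε = 0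
  form_kε : R.B k ε = μ / 2
  map_h : p h = 0
  map_k : p k = 0
  map_ε : p ε < 0
  κ_eq : ∃ m : ℕ, 2 ≤ m ∧ κ = 2 * Real.cos (Real.pi / m)
  μ_eq : ∃ n : ℕ, 2 ≤ n ∧ μ = 2 * Real.cos (Real.pi / n)
  γ_pos : 0 < R.ht γ
  γ_closure : ReflClosure R.B {h, k, ε} γ

namespace Config

variable {p : V →ₗ[ℝ] ℝ} {κ μ : ℝ} {h k ε γ a : V}

lemma γ_mem (C : R.Config p κ μ h k ε γ) : γ ∈ R.Φ :=
  closure_mem (by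
    rintro x (rfl | rfl | rfl)
    exacts [C.h_mem, C.k_mem, C.ε_mem]) C.γ_closure

lemma mem_of_eq (C : R.Config p κ μ h k ε γ) (ha : a = h ∨ a = k) : a ∈ R.Φ := by
  rcases ha with rfl | rfl
  exacts [C.h_mem, C.k_mem]

lemma κ_nonneg (C : R.Config p κ μ h k ε γ) : 0 ≤ κ := by
  obtain ⟨m, hm, rfl⟩ := C.κ_eq
  exact two_cos_pi_div_nonneg hm

lemma μ_nonneg (C : R.Config p κ μ h k ε γ) : 0 ≤ μ := by
  obtain ⟨m, hm, rfl⟩ := C.μ_eq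
  exact two_cos_pi_div_nonneg hm

lemma form_smul_h (C : R.Config p κ μ h k ε γ) (x y z : ℝ) :
    R.B h (x • h + y • k + z • ε) = x - κ / 2 * y := by
  simp only [map_add, map_smul, smul_eq_mul, R.norm _ C.h_mem, C.form_hk, C.form_hε]
  ring

lemma form_smul_k (C : R.Config p κ μ h k ε γ) (x y z : ℝ) :
    R.B k (x • h + y • k + z • ε) = -(κ / 2) * x + y + μ / 2 * z := by
  simp only [map_add, map_smul, smul_eq_mul, R.norm _ C.k_mem, R.symm k h, C.form_hk, C.form_kε]
  ring

lemma form_smul_ε (C : R.Config p κ μ h k ε γ) (x y z : ℝ) :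
    R.B ε (x • h + y • k + z • ε) = μ / 2 * y + z := by
  simp only [map_add, map_smul, smul_eq_mul, R.norm _ C.ε_mem, R.symm ε h, R.symm ε k, C.form_hε,
    C.form_kε]
  ring

lemma form_smul (C : R.Config p κ μ h k ε γ) (x y z x' y' z' : ℝ) :
    R.B (x • h + y • k + z • ε) (x' • h + y' • k + z' • ε) =
      x * (x' - κ / 2 * y') + y * (-(κ / 2) * x' + y' + μ / 2 * z') + z * (μ / 2 * y' + z') := by
  rw [LinearMap.map_add₂, LinearMap.map_add₂, LinearMap.map_smul₂, LinearMap.map_smul₂,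
    LinearMap.map_smul₂, C.form_smul_h, C.form_smul_k, C.form_smul_ε]
  simp only [smul_eq_mul]

lemma exists_coords_sub (C : R.Config p κ μ h k ε γ) (ha : a = h ∨ a = k) (hd : R.Dom γ a) :
    ∃ x y z : ℝ, γ - a = x • h + y • k + z • ε ∧
      (x - κ / 2 * y) ^ 2 + (z + μ / 2 * y) ^ 2 + (1 - (κ ^ 2 + μ ^ 2) / 4) * y ^ 2 ≤ 0 := by
  have hform := hd.one_le_form C.γ_mem (C.mem_of_eq ha)
  have hn : R.B (γ - a) (γ - a) ≤ 0 := by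
    simp only [map_sub, LinearMap.sub_apply, R.norm _ C.γ_mem, R.norm _ (C.mem_of_eq ha),
      R.symm a γ]
    linarith
  obtain ⟨x, y, z, hxyz⟩ : ∃ x y z : ℝ, γ - a = x • h + y • k + z • ε := by
    obtain ⟨x, y, z, hxyz⟩ := C.γ_closure.exists_coords
    rcases ha with rfl | rfl
    · exact ⟨x - 1, y, z, by rw [hxyz]; module⟩
    · exact ⟨x, y - 1, z, by rw [hxyz]; module⟩
  refine ⟨x, y, z, hxyz, ?_⟩
  rw [hxyz, C.form_smul] at hn
  linarith

lemma four_le (C : R.Config p κ μ h k ε γ) (ha : a = h ∨ a = k) (hd : R.Dom γ a) (hne : γ ≠ a) :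
    4 ≤ κ ^ 2 + μ ^ 2 := by
  by_contra! hlt
  obtain ⟨x, y, z, hxyz, hq⟩ := C.exists_coords_sub ha hd
  have h1 : 0 ≤ (1 - (κ ^ 2 + μ ^ 2) / 4) * y ^ 2 := mul_nonneg (by linarith) (sq_nonneg y)
  have hy : y = 0 := by
    have : (1 - (κ ^ 2 + μ ^ 2) / 4) * y ^ 2 = 0 := by
      linarith [sq_nonneg (x - κ / 2 * y), sq_nonneg (z + μ / 2 * y)]
    exact pow_eq_zero_iff two_ne_zero |>.1 ((mul_eq_zero.1 this).resolve_left (by linarith))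
  subst hy
  have hx : x = 0 := by nlinarith
  have hz : z = 0 := by nlinarith
  subst hx hz
  exact hne (sub_eq_zero.1 (by rw [hxyz]; module))

/-- In the affine case `γ - a` is orthogonal to `h` and `k`. -/
lemma form_sub_eq_zero (C : R.Config p κ μ h k ε γ) (ha : a = h ∨ a = k) (hd : R.Dom γ a)
    (h4 : κ ^ 2 + μ ^ 2 = 4) : R.B h (γ - a) = 0 ∧ R.B k (γ - a) = 0 := by
  obtain ⟨x, y, z, hxyz, hq⟩ := C.exists_coords_sub ha hd
  rw [h4] at hq
  have hx : x - κ / 2 * y = 0 := by nlinarith [sq_nonneg (z + μ / 2 * y)]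
  have hz : z + μ / 2 * y = 0 := by nlinarith [sq_nonneg (x - κ / 2 * y)]
  rw [hxyz, C.form_smul_h, C.form_smul_k]
  refine ⟨hx, ?_⟩
  obtain rfl : x = κ / 2 * y := by linarith
  obtain rfl : z = -(μ / 2 * y) := by linarith
  linear_combination (-(y / 4)) * h4

/-- No simple path system can generate `h, k, ε` with `h` and `k` in its two edges. -/
lemma not_pathBasis (C : R.Config p κ μ h k ε γ) (ha : a = h ∨ a = k) (hd : R.Dom γ a)
    (hne : γ ≠ a) {κ' μ' : ℝ} {e₁ e₂ e₃ : V} (hE : R.PathBasis κ' μ' e₁ e₂ e₃)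
    (hh : ReflClosure R.B {e₁, e₂, e₃} h) (hk : ReflClosure R.B {e₁, e₂, e₃} k)
    (hε : ReflClosure R.B {e₁, e₂, e₃} ε) {u u' w w' : ℝ} (hu : h = u • e₁ + u' • e₂)
    (hw : k = w • e₃ + w' • e₂) : False := by
  have hγ : ReflClosure R.B {e₁, e₂, e₃} γ := C.γ_closure.trans (by
    rintro x (rfl | rfl | rfl) <;> assumption)
  rcases ha with rfl | rfl
  · exact hne (hE.eq_of_dom hu hh C.h_pos hγ C.γ_pos hd)
  · have hset : ({e₁, e₂, e₃} : Set V) = {e₃, e₂, e₁} := by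
      ext x; simp; tauto
    rw [hset] at hk hγ
    exact hne (hE.symm.eq_of_dom hw hk C.k_pos hγ C.γ_pos hd)

/-- The root `μ ε - k` is positive. -/
lemma pos_t (C : R.Config p κ μ h k ε γ) (ha : a = h ∨ a = k) (hd : R.Dom γ a) (hne : γ ≠ a) :
    μ • ε - k ∈ R.Φ ∧ 0 < R.ht (μ • ε - k) := by
  have hτ : k - μ • ε = refl R.B ε k := by
    rw [refl_apply, R.symm, C.form_kε]; congr 2; ring
  have hτΦ : k - μ • ε ∈ R.Φ := hτ ▸ refl_mem C.ε_mem C.k_mem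
  have htΦ : μ • ε - k ∈ R.Φ := by rw [← neg_sub]; exact neg_mem hτΦ
  refine ⟨htΦ, ?_⟩
  by_contra! hcon
  have hτpos : 0 < R.ht (k - μ • ε) := by
    rw [← neg_sub, map_neg]
    have := R.ht_ne_zero _ htΦ
    rcases hcon.lt_or_eq with h' | h'
    · linarith
    · exact absurd h' this
  have hE : R.PathBasis κ μ h (k - μ • ε) ε := by
    refine ⟨C.h_mem, hτΦ, C.ε_mem, C.h_pos, hτpos, C.ε_pos, ?_, ?_, C.form_hε, C.κ_eq, C.μ_eq⟩
    · simp [C.form_hk, C.form_hε]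
    · simp [C.form_kε, R.norm _ C.ε_mem]; ring
  have hk : k = refl R.B ε (k - μ • ε) := by rw [hτ, refl_refl (R.norm _ C.ε_mem)]
  have hk' : ReflClosure R.B {h, k - μ • ε, ε} k := by
    have key : ReflClosure R.B {h, k - μ • ε, ε} (refl R.B ε (k - μ • ε)) :=
      .refl (.base (by simp)) (.base (by simp))
    rwa [← hk] at key
  exact C.not_pathBasis ha hd hne hE (.base (by simp)) hk' (.base (by simp))
    (u := 1) (u' := 0) (w := μ) (w' := 1) (by module) (by module)

/-- The roots `t = ε - k` and `δ = κ t - h` when `μ = 1`. -/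
lemma pos_δ (C : R.Config p κ 1 h k ε γ) (ha : a = h ∨ a = k) (hd : R.Dom γ a) (hne : γ ≠ a) :
    κ • (ε - k) - h ∈ R.Φ ∧ 0 < R.ht (κ • (ε - k) - h) := by
  obtain ⟨htΦ, htpos⟩ := C.pos_t ha hd hne
  rw [one_smul] at htΦ htpos
  have hht : R.B h (ε - k) = κ / 2 := by simp [C.form_hk, C.form_hε]
  have hkt : R.B k (ε - k) = -(1 / 2) := by
    simp [C.form_kε, R.norm _ C.k_mem]; norm_num
  have htt := R.norm _ htΦ
  set t := ε - k with ht
  have hr : h - κ • t = refl R.B t h := by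
    rw [refl_apply, R.symm, hht]; congr 2; ring
  have hrΦ : h - κ • t ∈ R.Φ := hr ▸ refl_mem htΦ C.h_mem
  have hδΦ : κ • t - h ∈ R.Φ := by rw [← neg_sub]; exact neg_mem hrΦ
  refine ⟨hδΦ, ?_⟩
  by_contra! hcon
  have hrpos : 0 < R.ht (h - κ • t) := by
    rw [← neg_sub, map_neg]
    rcases hcon.lt_or_eq with h' | h'
    · linarith
    · exact absurd h' (R.ht_ne_zero _ hδΦ)
  have hE : R.PathBasis κ 1 (h - κ • t) t k := by
    refine ⟨hrΦ, htΦ, C.k_mem, hrpos, htpos, C.k_pos, ?_, ?_, ?_, C.κ_eq, C.μ_eq⟩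
    · simp [hht, htt]; ring
    · rw [R.symm, hkt]
    · simp [C.form_hk, R.symm t k, hkt]; ring
  have hh : ReflClosure R.B {h - κ • t, t, k} h := by
    have key : ReflClosure R.B {h - κ • t, t, k} (refl R.B t (h - κ • t)) :=
      .refl (.base (by simp)) (.base (by simp))
    have e : refl R.B t (h - κ • t) = h := by rw [hr, refl_refl htt]
    rwa [e] at key
  have hε : ReflClosure R.B {h - κ • t, t, k} ε := by
    have key : ReflClosure R.B {h - κ • t, t, k} (refl R.B t k) :=
      .refl (.base (by simp)) (.base (by simp))
    have e : refl R.B t k = ε := by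
      rw [refl_apply, R.symm, hkt, ht]; module
    rwa [e] at key
  exact C.not_pathBasis ha hd hne hE hh (.base (by simp)) hε
    (u := 1) (u' := κ) (w := 1) (w' := 0) (by module) (by module)

lemma pos_δ₂ (C : R.Config p κ 1 h k ε γ) (ha : a = h ∨ a = k) (hd : R.Dom γ a) (hne : γ ≠ a) :
    κ • (κ • (ε - k) - h) - (ε - k) ∈ R.Φ ∧ 0 < R.ht (κ • (κ • (ε - k) - h) - (ε - k)) := by
  obtain ⟨htΦ, htpos⟩ := C.pos_t ha hd hne
  obtain ⟨hδΦ, hδpos⟩ := C.pos_δ ha hd hne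
  rw [one_smul] at htΦ htpos
  have hht : R.B h (ε - k) = κ / 2 := by simp [C.form_hk, C.form_hε]
  have hkt : R.B k (ε - k) = -(1 / 2) := by
    simp [C.form_kε, R.norm _ C.k_mem]; norm_num
  have htt := R.norm _ htΦ
  have hδδ := R.norm _ hδΦ
  set t := ε - k with ht
  have hδt : R.B (κ • t - h) t = κ / 2 := by simp [htt, hht]; ring
  have hδk : R.B (κ • t - h) k = 0 := by simp [R.symm t k, hkt, C.form_hk]; ring
  have htk : h = κ • t - (κ • t - h) := by module
  set δ := κ • t - h with hδ
  have hr : t - κ • δ = refl R.B δ t := by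
    rw [refl_apply, hδt]; congr 2; ring
  have hrΦ : t - κ • δ ∈ R.Φ := hr ▸ refl_mem hδΦ htΦ
  have hδ₂Φ : κ • δ - t ∈ R.Φ := by rw [← neg_sub]; exact neg_mem hrΦ
  refine ⟨hδ₂Φ, ?_⟩
  by_contra! hcon
  have hrpos : 0 < R.ht (t - κ • δ) := by
    rw [← neg_sub, map_neg]
    rcases hcon.lt_or_eq with h' | h'
    · linarith
    · exact absurd h' (R.ht_ne_zero _ hδ₂Φ)
  have hE : R.PathBasis κ 1 δ (t - κ • δ) k := by
    refine ⟨hδΦ, hrΦ, C.k_mem, hδpos, hrpos, C.k_pos, ?_, ?_, hδk, C.κ_eq, C.μ_eq⟩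
    · simp only [map_sub, map_smul, smul_eq_mul, hδt, hδδ]; ring
    · simp only [map_sub, map_smul, smul_eq_mul, LinearMap.sub_apply, LinearMap.smul_apply, hδk,
        R.symm t k, hkt]; ring
  have ht' : ReflClosure R.B {δ, t - κ • δ, k} t := by
    have key : ReflClosure R.B {δ, t - κ • δ, k} (refl R.B δ (t - κ • δ)) :=
      .refl (.base (by simp)) (.base (by simp))
    have e : refl R.B δ (t - κ • δ) = t := by rw [hr, refl_refl hδδ]
    rwa [e] at key
  have hh : ReflClosure R.B {δ, t - κ • δ, k} h := by
    have key : ReflClosure R.B {δ, t - κ • δ, k} (refl R.B t (-δ)) :=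
      .refl ht' (.neg (.base (by simp)) hδδ)
    have e : refl R.B t (-δ) = h := by
      rw [map_neg, refl_apply, R.symm t δ, hδt, hδ]; module
    rwa [e] at key
  have hε : ReflClosure R.B {δ, t - κ • δ, k} ε := by
    have key : ReflClosure R.B {δ, t - κ • δ, k} (refl R.B t k) :=
      .refl ht' (.base (by simp))
    have e : refl R.B t k = ε := by
      rw [refl_apply, R.symm, hkt, ht]; module
    rwa [e] at key
  exact C.not_pathBasis ha hd hne hE hh (.base (by simp)) hε
    (u := κ ^ 2 - 1) (u' := κ) (w := 1) (w' := 0) (by rw [htk]; module) (by module)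

end Config

end RootSys

end CoxeterSmall

namespace CoxeterSmall

namespace RootSys

variable {V : Type*} [AddCommGroup V] [Module ℝ V] {R : RootSys V}

/-- A small root `b` killed by `p` has no translate `b + l • ρ` which is a positive root on the
negative side of `p`, for `ρ` orthogonal to `b`. -/
lemma Small.not_add_smul_mem {b : V} (hb : R.Small b) {p : V →ₗ[ℝ] ℝ} (hp : R.IsHeightSum p)
    (hpb : p b = 0) {ρ : V} (hbρ : R.B b ρ = 0) (hpρ : p ρ < 0) {l : ℝ} (hl : 0 < l)
    (hmem : b + l • ρ ∈ R.Φ) (hpos : 0 < R.ht (b + l • ρ)) : False := by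
  have h1 := hb.form_lt_one hp hpb hmem hpos (by
    simp only [map_add, map_smul, smul_eq_mul, hpb]
    nlinarith)
  simp [R.norm b hb.1, hbρ] at h1

namespace Config

variable {p : V →ₗ[ℝ] ℝ} {κ μ : ℝ} {h k ε γ a b : V} {m : ℕ} {c c' : ℝ}

lemma not_affine (C : R.Config p κ 1 h k ε γ) (hp : R.IsHeightSum p) (ha : a = h ∨ a = k)
    (hd : R.Dom γ a) (hne : γ ≠ a) (hκ : κ ^ 2 = 3) (hb : R.Small b)
    (hbc : b = h + κ • k ∨ b = (2 : ℝ) • h + κ • k) : False := by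
  have hκ0 : 0 < κ := by
    rcases C.κ_nonneg.lt_or_eq with h' | h'
    · exact h'
    · rw [← h'] at hκ; norm_num at hκ
  obtain ⟨hhρ, hkρ⟩ := C.form_sub_eq_zero ha hd (by linarith)
  have hbρ : R.B b (γ - a) = 0 := by
    rcases hbc with rfl | rfl
    · rw [LinearMap.map_add₂, LinearMap.map_smul₂, hhρ, hkρ]; simp
    · rw [LinearMap.map_add₂, LinearMap.map_smul₂, LinearMap.map_smul₂, hhρ, hkρ]; simp
  have hpb : p b = 0 := by
    rcases hbc with rfl | rfl <;> simp [C.map_h, C.map_k]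
  have hpa : p a = 0 := by
    rcases ha with rfl | rfl
    exacts [C.map_h, C.map_k]
  have hpρ : p (γ - a) < 0 := by
    obtain ⟨l, -, hl⟩ := hd.heightSum_lt hp C.γ_mem (C.mem_of_eq ha) hne
    rw [hpa, mul_zero] at hl
    rw [map_sub, hpa]; linarith
  have h1 := C.h_pos
  have h2 := C.k_pos
  have h3 := C.γ_pos
  have hhh := R.norm _ C.h_mem
  have hkk := R.norm _ C.k_mem
  have hkh : R.B k h = -(κ / 2) := by rw [R.symm, C.form_hk]
  rw [map_sub, sub_eq_zero] at hhρ hkρ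
  rcases ha with rfl | rfl
  · have hγh : R.B γ a = 1 := by rw [R.symm, hhρ, hhh]
    have hγk : R.B γ k = -(κ / 2) := by rw [R.symm, hkρ, hkh]
    have hr : b + (1 : ℝ) • (γ - a) ∈ R.Φ := by
      rcases hbc with rfl | rfl
      · have e : refl R.B k γ = a + κ • k + (1 : ℝ) • (γ - a) := by
          rw [refl_apply, hkρ, hkh]; module
        exact e ▸ refl_mem C.k_mem C.γ_mem
      · have e1 : refl R.B a ((2 : ℝ) • a + κ • k) = a + κ • k := by
          rw [refl_apply, map_add, map_smul, map_smul, hhh, C.form_hk]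
          match_scalars
          · simp; linarith
          · simp
        have e : refl R.B γ (a + κ • k) = (2 : ℝ) • a + κ • k + (1 : ℝ) • (γ - a) := by
          rw [refl_apply, map_add, map_smul, hγh, hγk]
          match_scalars <;> simp <;> linarith
        exact e ▸ refl_mem C.γ_mem (e1 ▸ refl_mem C.h_mem hb.1)
    refine hb.not_add_smul_mem hp hpb hbρ hpρ one_pos hr ?_
    rcases hbc with rfl | rfl <;> simp only [map_add, map_smul, map_sub, smul_eq_mul] <;>
      nlinarith [mul_pos hκ0 h2]
  · have hγh : R.B γ h = -(κ / 2) := by rw [R.symm, hhρ, C.form_hk]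
    have hγk : R.B γ a = 1 := by rw [R.symm, hkρ, hkk]
    have hr : b + κ • (γ - a) ∈ R.Φ := by
      rcases hbc with rfl | rfl
      · have e : refl R.B γ h = h + κ • a + κ • (γ - a) := by
          rw [refl_apply, hγh]; module
        exact e ▸ refl_mem C.γ_mem C.h_mem
      · have hk' : refl R.B h γ = γ + κ • h := by
          rw [refl_apply, hhρ, C.form_hk]; module
        have e : refl R.B (γ + κ • h) (-h) = (2 : ℝ) • h + κ • a + κ • (γ - a) := by
          rw [refl_apply, map_neg, LinearMap.map_add₂, LinearMap.map_smul₂, hγh, hhh]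
          match_scalars <;> simp <;> linarith
        exact e ▸ refl_mem (hk' ▸ refl_mem C.h_mem C.γ_mem) (neg_mem C.h_mem)
    refine hb.not_add_smul_mem hp hpb hbρ hpρ hκ0 hr ?_
    rcases hbc with rfl | rfl <;> simp only [map_add, map_smul, map_sub, smul_eq_mul] <;>
      nlinarith [mul_pos hκ0 h3]

theorem not_small_comb (C : R.Config p κ μ h k ε γ) (hp : R.IsHeightSum p) (ha : a = h ∨ a = k)
    (hd : R.Dom γ a) (hne : γ ≠ a) (hb : R.Small b) (hbc : b = c • h + c' • k)
    (hc : CoefPair m κ c c') : False := by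
  have hpb : p b = 0 := by rw [hbc]; simp [C.map_h, C.map_k]
  have h4 := C.four_le ha hd hne
  obtain ⟨htΦ, htpos⟩ := C.pos_t ha hd hne
  have hB : ∀ v, R.B b v = c * R.B h v + c' * R.B k v := fun v => by
    rw [hbc, LinearMap.map_add₂, LinearMap.map_smul₂, LinearMap.map_smul₂]; simp
  have K1 : c' * μ < 2 := by
    have := hb.form_lt_one hp hpb C.ε_mem C.ε_pos C.map_ε
    rw [hB, C.form_hε, C.form_kε] at this
    linarith
  have hκ2 : κ < 2 := by
    obtain ⟨n, hn, rfl⟩ := C.κ_eq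
    exact two_cos_pi_div_lt_two hn
  have hκ0 := C.κ_nonneg
  have hμ0 : 0 < μ := by
    rcases C.μ_nonneg.lt_or_eq with h' | h'
    · exact h'
    · rw [← h'] at h4; nlinarith
  have K2 : c * κ + c' * (μ ^ 2 - 2) < 2 := by
    have := hb.form_lt_one hp hpb htΦ htpos (by
      simp only [map_sub, map_smul, smul_eq_mul, C.map_k]
      nlinarith [C.map_ε])
    rw [hB] at this
    simp only [map_sub, map_smul, smul_eq_mul, C.form_hε, C.form_hk, C.form_kε,
      R.norm _ C.k_mem] at this
    linarith
  have hc1 := hc.one_le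
  have hc1' := hc.symm.one_le
  by_cases hc'1 : c' = 1
  · have := hc.symm.eq_of_one hc'1
    subst this hc'1
    linarith
  have hκc' := hc.symm.eq_one_or_le.resolve_left hc'1
  have hκμ : κ * μ < 2 := by nlinarith
  obtain ⟨hκ22, hκpos⟩ := hc.bounds.resolve_left fun h1 => hc'1 (by
    have := hc.norm
    rw [h1] at this
    nlinarith [sq_nonneg (c - c'), mul_nonneg (sub_nonneg.2 hc1) (sub_nonneg.2 hc1')])
  have hμ1 : μ = 1 := by
    obtain ⟨n, hn, hμ⟩ := C.μ_eq
    rcases two_cos_pi_div_cases hn with h' | h' | h' <;> rw [← hμ] at h'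
    · linarith
    · exact h'
    · nlinarith [mul_pos hκpos hμ0]
  subst hμ1
  have h3 : 3 ≤ κ ^ 2 := by linarith
  obtain ⟨rfl, hcc⟩ := hc.symm.eq_of_lt_two h3 (by linarith) hc'1
  have hcub : c' ^ 3 - 2 * c' < 2 := by
    rcases hcc with rfl | rfl
    · obtain ⟨hδΦ, hδpos⟩ := C.pos_δ₂ ha hd hne
      have := hb.form_lt_one hp hpb hδΦ hδpos (by
        simp only [map_sub, map_smul, smul_eq_mul, C.map_k, C.map_h]
        nlinarith [C.map_ε])
      rw [hB] at this
      simp only [map_sub, map_smul, smul_eq_mul, C.form_hε, C.form_hk, C.form_kε,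
        R.norm _ C.k_mem, R.norm _ C.h_mem, R.symm k h] at this
      linarith
    · linarith
  have hsq := hc.sq_eq_three h3 hcub
  refine C.not_affine hp ha hd hne hsq hb ?_
  rcases hcc with rfl | rfl
  · left; rw [hbc, one_smul]
  · right; rw [hbc, hsq]; norm_num

end Config

/-- The left root of the canonical basis of a rank two subsystem is small as soon as the
subsystem contains a small root outside of the basis. -/
theorem PlaneBasis.small_left {a a' b : V} {c c' : ℝ} (h : R.PlaneBasis a a') (hb : R.Small b)
    (hc : 0 < c) (hc' : 0 < c') (hbc : b = c • a + c' • a') : R.Small a := by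
  refine ⟨h.left, fun γ hγ hγpos hd => by_contra fun hne => ?_⟩
  obtain ⟨m, κ, hpair, hform⟩ := h.exists_coefPair hb hc hc' hbc
  have hm : 3 ≤ m := hpair.1
  have hκ : κ = 2 * Real.cos (Real.pi / m) := hpair.2.1
  obtain ⟨p, hp, hpa, hpa'⟩ := exists_heightSum h.left h.right (m := m) (by omega)
    (by rw [hform, hκ]; ring)
  have hpb : p b = 0 := by rw [hbc]; simp [hpa, hpa']
  have hpγ : p γ < 0 := by
    obtain ⟨l, -, hl⟩ := hd.heightSum_lt hp hγ h.left hne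
    rwa [hpa, mul_zero] at hl
  obtain ⟨ε, hε⟩ := exists_maxWitness (a := a) (a' := a') hp hγ hγpos hpγ
  have hx := hε.form_nonneg h.left h.left_pos hpa
  have hy := hε.symm.form_nonneg h.right h.right_pos hpa'
  have hK := hb.form_lt_one hp hpb hε.1.1 hε.1.2.1 hε.1.2.2.1
  rw [hbc, LinearMap.map_add₂, LinearMap.map_smul₂, LinearMap.map_smul₂] at hK
  simp only [smul_eq_mul] at hK
  have hc1 := hpair.one_le
  have hc1' := hpair.symm.one_le
  have hxy : R.B a ε + R.B a' ε < 1 := by nlinarith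
  obtain ⟨n, hn, hxn⟩ := hε.exists_form_eq_cos hp h.left h.left_pos hpa (by linarith)
  obtain ⟨n', hn', hyn⟩ := hε.symm.exists_form_eq_cos hp h.right h.right_pos hpa' (by linarith)
  have half : ∀ N : ℕ, 2 ≤ N → Real.cos (Real.pi / N) = 0 ∨ 1 / 2 ≤ Real.cos (Real.pi / N) := by
    intro N hN
    rcases two_cos_pi_div_cases hN with h' | h' | h'
    · left; linarith
    · right; linarith
    · right; nlinarith
  rcases half n hn with h0 | h0
  · have C : R.Config p κ (2 * Real.cos (Real.pi / n')) a a' ε γ :=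
      ⟨h.left, h.right, hε.1.1, h.left_pos, h.right_pos, hε.1.2.1, hform, by rw [hxn, h0],
        by rw [hyn]; ring, hpa, hpa', hε.1.2.2.1, ⟨m, by omega, hκ⟩, ⟨n', hn', rfl⟩, hγpos,
        hε.1.2.2.2⟩
    exact C.not_small_comb hp (.inl rfl) hd hne hb hbc hpair
  · rcases half n' hn' with h0' | h0'
    · have C : R.Config p κ (2 * Real.cos (Real.pi / n)) a' a ε γ :=
        ⟨h.right, h.left, hε.1.1, h.right_pos, h.left_pos, hε.1.2.1, by rw [R.symm, hform],
          by rw [hyn, h0'], by rw [hxn]; ring, hpa', hpa, hε.1.2.2.1, ⟨m, by omega, hκ⟩,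
          ⟨n, hn, rfl⟩, hγpos, hε.symm.1.2.2.2⟩
      exact C.not_small_comb hp (.inr rfl) hd hne hb (by rw [hbc, add_comm]) hpair.symm
    · linarith

end RootSys

end CoxeterSmall

namespace CoxeterSmall

lemma exists_of_mem_coneOf_pair {V : Type*} [AddCommGroup V] [Module ℝ V] {x y v : V}
    (hv : v ∈ coneOf {x, y}) : ∃ i j : ℝ, 0 ≤ i ∧ 0 ≤ j ∧ v = i • x + j • y := by
  obtain ⟨n, c, z, hc, hz, rfl⟩ := hv
  refine Finset.sum_induction _ (fun v => ∃ i j : ℝ, 0 ≤ i ∧ 0 ≤ j ∧ v = i • x + j • y) ?_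
    ⟨0, 0, le_rfl, le_rfl, by module⟩ fun t _ => ?_
  · rintro _ _ ⟨i, j, hi, hj, rfl⟩ ⟨i', j', hi', hj', rfl⟩
    exact ⟨i + i', j + j', by positivity, by positivity, by module⟩
  · rcases hz t with h | h
    · exact ⟨c t, 0, hc t, le_rfl, by rw [h]; module⟩
    · exact ⟨0, c t, le_rfl, hc t, by rw [h]; module⟩

namespace RootSys

variable {V : Type*} [AddCommGroup V] [Module ℝ V] {R : RootSys V} {a a' : V}

lemma eq_of_eq_smul (ha : a ∈ R.Φ) (ha' : a' ∈ R.Φ) (hpos : 0 < R.ht a) (hpos' : 0 < R.ht a')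
    {c : ℝ} (h : a = c • a') : a = a' := by
  have h1 := R.norm a ha
  rw [h, map_smul, LinearMap.map_smul₂, R.norm a' ha'] at h1
  have h2 : R.ht a = c * R.ht a' := by rw [h]; simp
  have hc : 0 < c := by
    rw [h2] at hpos
    exact pos_of_mul_pos_left hpos hpos'.le
  simp only [smul_eq_mul, mul_one] at h1
  have : c = 1 := by nlinarith
  rw [h, this, one_smul]

lemma coords_eq_zero (ha : a ∈ R.Φ) (ha' : a' ∈ R.Φ) (hpos : 0 < R.ht a) (hpos' : 0 < R.ht a')
    (hne : a ≠ a') {i j : ℝ} (h : i • a + j • a' = 0) : i = 0 ∧ j = 0 := by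
  have hi : i = 0 := by
    by_contra hi
    refine hne (eq_of_eq_smul ha ha' hpos hpos' (c := -j / i) ?_)
    have : i • a = (-j) • a' := by rw [eq_neg_of_add_eq_zero_left h, neg_smul]
    rw [← inv_smul_smul₀ hi a, this, smul_smul]
    congr 1; field_simp
  subst hi
  refine ⟨rfl, ?_⟩
  have := congrArg R.ht h
  simp only [map_smul, zero_smul, map_zero, zero_add, smul_eq_mul] at this
  exact (mul_eq_zero.1 this).resolve_right hpos'.ne'

end RootSys

section Conversion

variable {S : Type*} [Fintype S] [DecidableEq S] {M : CoxeterMatrix S} {W : Type*} [Group W]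
  (cs : CoxeterSystem M W) (ρ : W →* ((S → ℝ) ≃ₗ[ℝ] (S → ℝ)))
  (hρ : ∀ (s : S) (v : S → ℝ), ρ (cs.simple s) v = refl (form M) (simpleRoot s) v)

lemma dominates_iff {a b : S → ℝ} (ha : a ∈ rootSet ρ) (hb : b ∈ rootSet ρ) :
    Dominates ρ a b ↔ (rootSys cs ρ hρ).Dom a b := by
  have key : ∀ (w : W) {v : S → ℝ}, v ∈ rootSet ρ →
      (ρ w v ∈ negRoots ρ ↔ coordSum S (ρ w v) < 0) := fun w v hv => by
    rw [mem_negRoots cs ρ hρ, and_iff_right (map_mem_rootSet ρ w hv)]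
  constructor
  · rintro h _ ⟨w, rfl⟩ hw
    exact (key w ha).1 (h w ((key w hb).2 hw))
  · intro h w hw
    exact (key w ha).2 (h (ρ w) ⟨w, rfl⟩ ((key w hb).1 hw))

lemma isSmallRoot_iff {b : S → ℝ} (hb : b ∈ posRoots ρ) :
    IsSmallRoot ρ b ↔ (rootSys cs ρ hρ).Small b := by
  have hbΦ := ((mem_posRoots cs ρ hρ).1 hb).1
  constructor
  · rintro ⟨-, h⟩
    exact ⟨hbΦ, fun γ hγ hpos hd => h γ ((mem_posRoots cs ρ hρ).2 ⟨hγ, hpos⟩)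
      ((dominates_iff cs ρ hρ hγ hbΦ).2 hd)⟩
  · rintro ⟨-, h⟩
    refine ⟨hb, fun γ hγ hd => ?_⟩
    obtain ⟨hγΦ, hpos⟩ := (mem_posRoots cs ρ hρ).1 hγ
    exact h γ hγΦ hpos ((dominates_iff cs ρ hρ hγΦ hbΦ).1 hd)

/-- The canonical basis of a maximal rank two subsystem. -/
lemma planeBasis_of_coneOf {P : Submodule ℝ (S → ℝ)} {a a' : S → ℝ} (hne : a ≠ a')
    (hD : {a, a'} ⊆ (↑P ∩ posRoots ρ))
    (hbasis : (↑P ∩ posRoots ρ) = coneOf {a, a'} ∩ rootSet ρ) :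
    (rootSys cs ρ hρ).PlaneBasis a a' := by
  obtain ⟨haP, ha⟩ := hD (Set.mem_insert a {a'})
  obtain ⟨haP', ha'⟩ := hD (Set.mem_insert_of_mem a rfl)
  obtain ⟨haΦ, hapos⟩ := (mem_posRoots cs ρ hρ).1 ha
  obtain ⟨haΦ', hapos'⟩ := (mem_posRoots cs ρ hρ).1 ha'
  have hpos : ∀ i j : ℝ, i • a + j • a' ∈ rootSet ρ → 0 < coordSum S (i • a + j • a') →
      0 ≤ i ∧ 0 ≤ j := by
    intro i j hΦ hp
    have hmem : i • a + j • a' ∈ (↑P ∩ posRoots ρ) :=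
      ⟨P.add_mem (P.smul_mem i haP) (P.smul_mem j haP'), (mem_posRoots cs ρ hρ).2 ⟨hΦ, hp⟩⟩
    rw [hbasis] at hmem
    obtain ⟨i', j', hi', hj', he⟩ := exists_of_mem_coneOf_pair hmem.1
    obtain ⟨h1, h2⟩ := RootSys.coords_eq_zero (R := rootSys cs ρ hρ) haΦ haΦ' hapos hapos' hne
      (i := i - i') (j := j - j') (by rw [← sub_eq_zero] at he; rw [← he]; module)
    exact ⟨by linarith, by linarith⟩
  refine ⟨haΦ, haΦ', hapos, hapos', fun i j hΦ => ?_⟩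
  rcases lt_or_gt_of_ne ((rootSys cs ρ hρ).ht_ne_zero _ hΦ) with h | h
  · right
    have e : -(i • a + j • a') = (-i) • a + (-j) • a' := by module
    have h1 : (-i) • a + (-j) • a' ∈ rootSet ρ := e ▸ neg_mem_rootSet cs ρ hρ hΦ
    have h2 : 0 < coordSum S ((-i) • a + (-j) • a') := by
      rw [← e, map_neg]; exact neg_pos.2 h
    obtain ⟨h3, h4⟩ := hpos _ _ h1 h2
    exact ⟨by linarith, by linarith⟩
  · exact .inl (hpos i j hΦ h)

end Conversion

end CoxeterSmall

/-- The set `Σ` of small roots is *bipodal*: for every small root `β` and every maximal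
rank 2 root subsystem `Φ' = P ∩ Φ` (`P` a plane meeting `Φ⁺` in at least two roots) with
canonical basis `Δ'` (the subset of `Φ' ∩ Φ⁺` of cardinality 2 such that
`P ∩ Φ⁺ = cone(Δ') ∩ Φ`), if `β ∈ Φ' \ Δ'` then `Δ' ⊆ Σ`. -/
theorem smallRoots_bipodal {S : Type*} [Fintype S] [DecidableEq S]
    (Mmat : CoxeterMatrix S) {W : Type*} [Group W] (cs : CoxeterSystem Mmat W)
    (ρ : W →* ((S → ℝ) ≃ₗ[ℝ] (S → ℝ)))
    (hfaith : Function.Injective ρ)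
    (hρ : ∀ (s : S) (v : S → ℝ),
      ρ (cs.simple s) v = v - (2 * bform Mmat (simpleRoot s) v) • simpleRoot s)
    (b : S → ℝ) (hb : IsSmallRoot ρ b)
    (P : Submodule ℝ (S → ℝ)) (hP : Module.finrank ℝ P = 2)
    (D : Set (S → ℝ)) (hD : D ⊆ (↑P ∩ posRoots ρ)) (hcard : D.ncard = 2)
    (hbasis : (↑P ∩ posRoots ρ) = coneOf D ∩ rootSet ρ)
    (hmem : b ∈ ((↑P ∩ rootSet ρ) \ D)) :
    ∀ a ∈ D, IsSmallRoot ρ a := by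
  have hρ' : ∀ (s : S) (v : S → ℝ), ρ (cs.simple s) v =
      CoxeterSmall.refl (CoxeterSmall.form Mmat) (simpleRoot s) v := fun s v => by
    rw [hρ, CoxeterSmall.refl_apply, CoxeterSmall.form_apply]
  obtain ⟨a, a', hne, rfl⟩ := Set.ncard_eq_two.1 hcard
  have hbase := CoxeterSmall.planeBasis_of_coneOf cs ρ hρ' hne hD hbasis
  have hbsmall := (CoxeterSmall.isSmallRoot_iff cs ρ hρ' hb.1).1 hb
  have hbpos := ((CoxeterSmall.mem_posRoots cs ρ hρ').1 hb.1).2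
  obtain ⟨⟨hbP, hbΦ⟩, hbD⟩ := hmem
  have hbcone : b ∈ coneOf {a, a'} ∩ rootSet ρ := hbasis ▸ ⟨hbP, hb.1⟩
  obtain ⟨c, c', hc, hc', hbc⟩ := CoxeterSmall.exists_of_mem_coneOf_pair hbcone.1
  have hc0 : 0 < c := by
    refine lt_of_le_of_ne hc fun h0 => hbD ?_
    rw [← h0, zero_smul, zero_add] at hbc
    exact .inr (CoxeterSmall.RootSys.eq_of_eq_smul (R := CoxeterSmall.rootSys cs ρ hρ') hbΦ
      hbase.right hbpos hbase.right_pos hbc)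
  have hc0' : 0 < c' := by
    refine lt_of_le_of_ne hc' fun h0 => hbD ?_
    rw [← h0, zero_smul, add_zero] at hbc
    exact .inl (CoxeterSmall.RootSys.eq_of_eq_smul (R := CoxeterSmall.rootSys cs ρ hρ') hbΦ
      hbase.left hbpos hbase.left_pos hbc)
  rintro x hx
  rw [CoxeterSmall.isSmallRoot_iff cs ρ hρ' (hD hx).2]
  rcases hx with rfl | rfl
  · exact hbase.small_left hbsmall hc0 hc0' hbc
  · exact hbase.symm.small_left hbsmall hc0' hc0 (by rw [hbc, add_comm])
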